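/- arXiv:1902.02483 — 7 statements merged into one kernel-verified Lean document; each statement's English description precedes it below -/
import Mathlib

section
/- For all integers p ≥ m ≥ 1, every real η > 0 and every real t ∈ (0,1], the Selberg-type integral identity (𝒦₁(m,m,p)·𝒦₂(m,m,p) / (η^{m−1} (1+η)^{p+1−m})) · ∫_{0 ≤ x₁ ≤ x₂ ≤ ⋯ ≤ x_m ≤ t} Δ_m(x)² · (∏_{j=1}^m x_j^{p−m}) · Σ_{k=1}^m [ (∏_{j≠k} (x_k − x_j))^{−1} · (1 − (η/(1+η)) x_k)^{−(p+1)} ] dx₁⋯dx_m = t^{mp} / (1 + η(1−t))^{p} holds. (This is the c.d.f. at t of the largest eigenvalue of the rank-one deformed Jacobi unitary ensemble in the balanced case n = m.) -/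
open MeasureTheory Finset

/-- Vandermonde determinant `∏_{i<j} (x j - x i)`. -/
noncomputable def vdm {m : ℕ} (x : Fin m → ℝ) : ℝ :=
  ∏ i : Fin m, ∏ j ∈ Finset.univ.filter (fun j => i < j), (x j - x i)

/-- The ordered region `0 ≤ x₁ ≤ x₂ ≤ ⋯ ≤ x_m ≤ t`. -/
def orderedRegion (m : ℕ) (t : ℝ) : Set (Fin m → ℝ) :=
  {x | (∀ i j : Fin m, i ≤ j → x i ≤ x j) ∧ (∀ i, 0 ≤ x i) ∧ (∀ i, x i ≤ t)}

/-- `𝒦₁(m,n,p) = ∏_{j=1}^m (n+p−j)! / ((m−j)! (n−j)! (p−j)!)`. -/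
noncomputable def K1 (m n p : ℕ) : ℝ :=
  ∏ j ∈ Finset.Icc 1 m,
    (Nat.factorial (n + p - j) : ℝ) /
      ((Nat.factorial (m - j) : ℝ) * (Nat.factorial (n - j) : ℝ) * (Nat.factorial (p - j) : ℝ))

/-- `𝒦₂(m,n,p) = (m−1)! (n+p−m)! / (n+p−1)!`. -/
noncomputable def K2 (m n p : ℕ) : ℝ :=
  ((Nat.factorial (m - 1) : ℝ) * (Nat.factorial (n + p - m) : ℝ)) / (Nat.factorial (n + p - 1) : ℝ)

theorem ae_injective_pi (m : ℕ) : ∀ᵐ x : Fin m → ℝ, Function.Injective x := by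
  have key : ∀ i j : Fin m, i ≠ j → ∀ᵐ x : Fin m → ℝ, x i ≠ x j := by
    intro i j hij
    let L : (Fin m → ℝ) →ₗ[ℝ] ℝ := LinearMap.proj (R := ℝ) (φ := fun _ : Fin m => ℝ) i -
      LinearMap.proj (R := ℝ) (φ := fun _ : Fin m => ℝ) j
    have hL : LinearMap.ker L ≠ ⊤ := by
      intro h
      have hmem : Pi.single i (1 : ℝ) ∈ LinearMap.ker L := h ▸ Submodule.mem_top
      simp [L, hij.symm] at hmem
    rw [ae_iff]
    convert Measure.addHaar_submodule (volume : Measure (Fin m → ℝ)) (LinearMap.ker L) hL using 2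
    ext x
    simp [L, sub_eq_zero]
  have : ∀ᵐ x : Fin m → ℝ, ∀ i j : Fin m, i ≠ j → x i ≠ x j := by
    rw [ae_all_iff]; intro i
    rw [ae_all_iff]; intro j
    by_cases hij : i = j
    · simp [hij]
    · filter_upwards [key i j hij] with x hx _ using hx
  filter_upwards [this] with x hx i j h
  by_contra hne
  exact hx i j hne h

theorem measurableSet_orderedRegion (m : ℕ) (t : ℝ) : MeasurableSet (orderedRegion m t) := by
  apply IsClosed.measurableSet
  have h : orderedRegion m t =
      (⋂ i : Fin m, ⋂ j : Fin m, ⋂ _ : i ≤ j, {x : Fin m → ℝ | x i ≤ x j}) ∩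
        ((⋂ i : Fin m, {x : Fin m → ℝ | 0 ≤ x i}) ∩ ⋂ i : Fin m, {x : Fin m → ℝ | x i ≤ t}) := by
    ext x
    simp [orderedRegion]
  rw [h]
  refine (isClosed_iInter fun i => isClosed_iInter fun j => isClosed_iInter fun _ =>
    isClosed_le (continuous_apply i) (continuous_apply j)).inter
      ((isClosed_iInter fun i => isClosed_le continuous_const (continuous_apply i)).inter
        (isClosed_iInter fun i => isClosed_le (continuous_apply i) continuous_const))

/-- The cube `[0,t]^m` is tiled by the images of the ordered region under permutations. -/
theorem sum_perm_setIntegral_orderedRegion {m : ℕ} {t : ℝ} (G : (Fin m → ℝ) → ℝ)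
    (hG : IntegrableOn G (Set.univ.pi fun _ : Fin m => Set.Icc 0 t)) :
    ∑ σ : Equiv.Perm (Fin m), ∫ x in orderedRegion m t, G (x ∘ σ) =
      ∫ x in Set.univ.pi fun _ : Fin m => Set.Icc 0 t, G x := by
  let e : Equiv.Perm (Fin m) → (Fin m → ℝ) ≃ᵐ (Fin m → ℝ) := fun σ =>
    MeasurableEquiv.arrowCongr' σ (MeasurableEquiv.refl ℝ)
  have he : ∀ σ (x : Fin m → ℝ), e σ x = x ∘ σ.symm := fun σ x => rfl
  have hmp : ∀ σ, MeasurePreserving (e σ) volume volume := fun σ =>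
    volume_preserving_arrowCongr' σ (MeasurableEquiv.refl ℝ) (MeasurePreserving.id _)
  have hcov : (Set.univ.pi fun _ : Fin m => Set.Icc (0 : ℝ) t) =
      ⋃ σ, e σ ⁻¹' orderedRegion m t := by
    ext x
    simp only [Set.mem_pi, Set.mem_univ, true_imp_iff, Set.mem_iUnion, Set.mem_preimage, he,
      orderedRegion, Set.mem_ofPred_eq, Function.comp, Set.mem_Icc]
    constructor
    · intro h
      refine ⟨(Tuple.sort x).symm, fun i j hij => ?_, fun i => (h _).1, fun i => (h _).2⟩
      exact Tuple.monotone_sort x hij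
    · rintro ⟨σ, -, h0, h1⟩ i
      refine ⟨?_, ?_⟩
      · simpa using h0 (σ i)
      · simpa using h1 (σ i)
  have hterm : ∀ σ : Equiv.Perm (Fin m), ∫ x in orderedRegion m t, G (x ∘ σ) =
      ∫ x in e σ ⁻¹' orderedRegion m t, G x := by
    intro σ
    rw [← (hmp σ).setIntegral_preimage_emb (e σ).measurableEmbedding]
    congr 1
    ext x
    rw [he]
    congr 1
    ext i
    simp
  rw [hcov] at hG ⊢
  rw [integral_iUnion_ae (fun σ => ((e σ).measurable
    (measurableSet_orderedRegion m t)).nullMeasurableSet) ?_ hG, tsum_fintype]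
  · exact Finset.sum_congr rfl fun σ _ => hterm σ
  · intro σ τ hστ
    refine measure_mono_null ?_ (ae_iff.1 (ae_injective_pi m))
    rintro x ⟨h1, h2⟩ hx
    have h := Tuple.unique_monotone (f := x) (σ := σ.symm) (τ := τ.symm)
      (fun i j hij => h1.1 i j hij) (fun i j hij => h2.1 i j hij)
    apply hστ
    have h' : σ.symm = τ.symm := Equiv.ext fun i => hx (congrFun h i)
    simpa using congrArg Equiv.symm h'

/-- Andréief's identity, on the ordered region. -/
theorem setIntegral_orderedRegion_det_mul_det {m : ℕ} {t : ℝ} (A B : Fin m → ℝ → ℝ)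
    (hAB : ∀ i j, IntegrableOn (fun y => A i y * B j y) (Set.Icc 0 t)) :
    ∫ x in orderedRegion m t, (Matrix.of fun i j => A i (x j)).det *
        (Matrix.of fun i j => B i (x j)).det =
      (Matrix.of fun i j => ∫ y in Set.Icc 0 t, A i y * B j y).det := by
  let G : (Fin m → ℝ) → ℝ := fun x => (Matrix.of fun i j => A i (x j)).det * ∏ j, B j (x j)
  have hGexp : G = fun x => ∑ τ : Equiv.Perm (Fin m),
      ((Equiv.Perm.sign τ : ℤ) : ℝ) * ∏ j, (A (τ j) (x j) * B j (x j)) := by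
    ext x
    simp only [G, Matrix.det_apply', Matrix.of_apply, Finset.sum_mul, mul_assoc,
      Finset.prod_mul_distrib]
  have hrestr : (volume : Measure (Fin m → ℝ)).restrict
      (Set.univ.pi fun _ : Fin m => Set.Icc 0 t) =
        Measure.pi fun _ : Fin m => (volume : Measure ℝ).restrict (Set.Icc 0 t) := by
    rw [volume_pi, Measure.restrict_pi_pi]
  have hterm : ∀ τ : Equiv.Perm (Fin m), IntegrableOn
      (fun x : Fin m → ℝ => ((Equiv.Perm.sign τ : ℤ) : ℝ) * ∏ j, (A (τ j) (x j) * B j (x j)))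
      (Set.univ.pi fun _ : Fin m => Set.Icc 0 t) := by
    intro τ
    rw [IntegrableOn, hrestr]
    exact (Integrable.fintype_prod (f := fun j y => A (τ j) y * B j y)
      (fun j => hAB (τ j) j)).const_mul _
  have hG : IntegrableOn G (Set.univ.pi fun _ : Fin m => Set.Icc 0 t) := by
    rw [hGexp]
    exact integrable_finsetSum _ fun τ _ => hterm τ
  have hsum := sum_perm_setIntegral_orderedRegion G hG
  have hint : ∀ σ : Equiv.Perm (Fin m), IntegrableOn (fun x => G (x ∘ σ)) (orderedRegion m t) := by
    intro σ
    have hmp : MeasurePreserving (MeasurableEquiv.arrowCongr' σ.symm (MeasurableEquiv.refl ℝ))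
        (volume : Measure (Fin m → ℝ)) volume :=
      volume_preserving_arrowCongr' σ.symm (MeasurableEquiv.refl ℝ) (MeasurePreserving.id _)
    refine ((hmp.integrableOn_comp_preimage (MeasurableEquiv.measurableEmbedding _)).2 hG).mono_set
      ?_
    intro x hx
    simp only [Set.mem_preimage, Set.mem_pi, Set.mem_univ, true_imp_iff]
    exact fun i => ⟨hx.2.1 (σ i), hx.2.2 (σ i)⟩
  have hpt : ∀ x : Fin m → ℝ, (Matrix.of fun i j => A i (x j)).det *
      (Matrix.of fun i j => B i (x j)).det = ∑ σ : Equiv.Perm (Fin m), G (x ∘ σ) := by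
    intro x
    rw [← Matrix.det_transpose (Matrix.of fun i j => B i (x j)), 
      Matrix.det_apply' (Matrix.of fun i j => B i (x j)).transpose, Finset.mul_sum]
    refine Finset.sum_congr rfl fun σ _ => ?_
    have : (Matrix.of fun i j => A i ((x ∘ σ) j)).det =
        ((Equiv.Perm.sign σ : ℤ) : ℝ) * (Matrix.of fun i j => A i (x j)).det := by
      rw [← Matrix.det_permute']
      rfl
    simp only [G, this, Matrix.transpose_apply, Matrix.of_apply]
    simp only [Function.comp]
    ring
  simp_rw [hpt]
  rw [integral_finsetSum _ fun σ _ => hint σ, hsum, hGexp,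
    integral_finsetSum _ fun τ _ => hterm τ, Matrix.det_apply']
  refine Finset.sum_congr rfl fun τ _ => ?_
  rw [integral_const_mul, hrestr]
  congr 1
  exact integral_fintype_prod_eq_prod (fun j y => A (τ j) y * B j y)

theorem vdm_eq_det_vandermonde {m : ℕ} (x : Fin m → ℝ) :
    vdm x = (Matrix.vandermonde x).det := by
  rw [Matrix.det_vandermonde, vdm]
  refine Finset.prod_congr rfl fun i _ => Finset.prod_congr ?_ fun _ _ => rfl
  ext j
  simp

theorem vdm_eq_det_eval {m : ℕ} (x : Fin m → ℝ) (q : Fin m → Polynomial ℝ)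
    (hdeg : ∀ i, (q i).natDegree = i) (hmonic : ∀ i, (q i).Monic) :
    vdm x = (Matrix.of fun i j => (q i).eval (x j)).det := by
  rw [vdm_eq_det_vandermonde,
    Matrix.det_eval_matrixOfPolynomials_eq_det_vandermonde x q hdeg hmonic,
    ← Matrix.det_transpose]
  rfl

/-- A divided difference as a quotient of determinants. -/
theorem vdm_mul_sum_eq_det {n : ℕ} (x : Fin (n + 1) → ℝ) (hx : Function.Injective x)
    (f : ℝ → ℝ) :
    vdm x * ∑ k, (∏ j ∈ Finset.univ.erase k, (x k - x j))⁻¹ * f (x k) =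
      (Matrix.of fun i j => if i = Fin.last n then f (x j) else x j ^ (i : ℕ)).det := by
  let P : Polynomial ℝ := Lagrange.interpolate Finset.univ x (fun k => f (x k))
  have hinj : Set.InjOn x (Finset.univ : Finset (Fin (n + 1))) := hx.injOn
  have hPdeg : P.degree < (Finset.univ : Finset (Fin (n + 1))).card :=
    Lagrange.degree_interpolate_lt _ hinj
  have hPeval : ∀ k, P.eval (x k) = f (x k) := fun k =>
    Lagrange.eval_interpolate_at_node _ hinj (Finset.mem_univ k)
  have hcoeff := Lagrange.coeff_eq_sum hinj hPdeg
  have hPnat : P.natDegree < n + 1 := by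
    rw [Finset.card_univ, Fintype.card_fin] at hPdeg
    by_cases h0 : P = 0
    · simp [h0]
    · exact (Polynomial.natDegree_lt_iff_degree_lt h0).2 hPdeg
  have hmat : (Matrix.of fun i j => if i = Fin.last n then f (x j) else x j ^ (i : ℕ)) =
      (Matrix.vandermonde x).transpose.updateRow (Fin.last n)
        (∑ k, P.coeff (k : Fin (n + 1)) • (Matrix.vandermonde x).transpose k) := by
    ext i j
    by_cases hi : i = Fin.last n
    · subst hi
      simp only [Matrix.of_apply, if_true, Matrix.updateRow_self, Finset.sum_apply, Pi.smul_apply,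
        Matrix.transpose_apply, Matrix.vandermonde_apply, smul_eq_mul]
      rw [← hPeval, Polynomial.eval_eq_sum_range' hPnat, Finset.sum_range]
    · simp [hi, Matrix.vandermonde_apply]
  rw [hmat, Matrix.det_updateRow_sum, Matrix.det_transpose, vdm_eq_det_vandermonde, smul_eq_mul,
    mul_comm]
  congr 1
  simp only [Finset.card_univ, Fintype.card_fin, Nat.add_sub_cancel] at hcoeff
  rw [Fin.val_last, hcoeff]
  refine Finset.sum_congr rfl fun k _ => ?_
  rw [hPeval, div_eq_mul_inv, mul_comm]

open Polynomial in
/-- Rodrigues' formula for the Jacobi polynomials on `[0,t]`, made monic. -/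
theorem exists_monic_rodrigues (a i : ℕ) (t : ℝ) :
    ∃ q : ℝ[X], q.natDegree = i ∧ q.Monic ∧ X ^ a * q =
      C ((-1) ^ i * ((a + i).factorial : ℝ) / (a + 2 * i).factorial) *
        derivative^[i] (X ^ (a + i) * (C t - X) ^ i) := by
  set R : ℝ[X] := derivative^[i] (X ^ (a + i) * (C t - X) ^ i) with hR
  set c : ℝ := (-1) ^ i * ((a + i).factorial : ℝ) / (a + 2 * i).factorial with hc
  obtain ⟨q₀, hq₀⟩ : X ^ a ∣ R := by
    have := pow_sub_dvd_iterate_derivative_of_pow_dvd i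
      (dvd_mul_right ((X : ℝ[X]) ^ (a + i)) ((C t - X) ^ i))
    rwa [Nat.add_sub_cancel] at this
  have hlin : (C t - X : ℝ[X]).natDegree ≤ 1 := by
    rw [← neg_sub, natDegree_neg, natDegree_X_sub_C]
  have hPdeg : (X ^ (a + i) * (C t - X) ^ i : ℝ[X]).natDegree ≤ a + 2 * i := by
    refine natDegree_mul_le.trans ?_
    have := natDegree_pow_le_of_le i hlin
    rw [natDegree_X_pow]
    omega
  have hcoef : ∀ k, q₀.coeff k =
      ((k + a + i).descFactorial i : ℝ) * (X ^ (a + i) * (C t - X) ^ i : ℝ[X]).coeff (k + a + i) := by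
    intro k
    rw [← coeff_X_pow_mul q₀ a k, ← hq₀, hR, coeff_iterate_derivative, nsmul_eq_mul]
  have htop : (X ^ (a + i) * (C t - X) ^ i : ℝ[X]).coeff (i + a + i) = (-1) ^ i := by
    rw [add_assoc, coeff_X_pow_mul]
    have := coeff_pow_of_natDegree_le (m := i) hlin
    rw [mul_one] at this
    rw [this]
    simp [coeff_X]
  have hdesc : ((a + i).factorial : ℝ) * ((a + 2 * i).descFactorial i : ℝ) =
      (a + 2 * i).factorial := by
    have := Nat.factorial_mul_descFactorial (n := a + 2 * i) (k := i) (by omega)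
    rw [show a + 2 * i - i = a + i by omega] at this
    exact_mod_cast this
  have hdeg : (C c * q₀).natDegree ≤ i := by
    rw [natDegree_le_iff_coeff_eq_zero]
    intro k hk
    rw [coeff_C_mul, hcoef, coeff_eq_zero_of_natDegree_lt (by omega), mul_zero, mul_zero]
  have hone : (C c * q₀).coeff i = 1 := by
    rw [coeff_C_mul, hcoef, htop, show i + a + i = a + 2 * i by ring, hc]
    have h0 : ((a + 2 * i).factorial : ℝ) ≠ 0 := by positivity
    have hs : ((-1 : ℝ) ^ i) * (-1) ^ i = 1 := by rw [← mul_pow]; simp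
    field_simp
    linear_combination (a + 2 * i).factorial * hs + (-1) ^ i * (-1) ^ i * hdesc
  have hm : (C c * q₀).Monic := monic_of_natDegree_le_of_coeff_eq_one i hdeg hone
  refine ⟨C c * q₀, le_antisymm hdeg (le_natDegree_of_ne_zero (by rw [hone]; exact one_ne_zero)),
    hm, ?_⟩
  rw [hq₀]
  ring

open Polynomial in
/-- Iterated integration by parts against a polynomial vanishing to order `i` at both endpoints. -/
theorem integral_iterate_derivative_mul {t : ℝ} (ht : 0 ≤ t) (i b : ℕ) (hb : i ≤ b)
    (f : ℕ → ℝ → ℝ) (hf : ∀ k, ∀ y ∈ Set.Icc 0 t, HasDerivAt (f k) (f (k + 1) y) y) :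
    ∫ y in (0 : ℝ)..t, (derivative^[i] (X ^ b * (C t - X) ^ i : ℝ[X])).eval y * f 0 y =
      (-1) ^ i * ∫ y in (0 : ℝ)..t, y ^ b * (t - y) ^ i * f i y := by
  set P : ℝ[X] := X ^ b * (C t - X) ^ i with hP
  have hcont : ∀ k, ContinuousOn (f k) (Set.uIcc 0 t) := fun k y hy => by
    rw [Set.uIcc_of_le ht] at hy
    exact (hf k y hy).continuousAt.continuousWithinAt
  have hz : ∀ k < i, (derivative^[k] P).eval 0 = 0 ∧ (derivative^[k] P).eval t = 0 := by
    intro k hk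
    constructor
    · have h := pow_sub_dvd_iterate_derivative_of_pow_dvd k
        (dvd_mul_right ((X : ℝ[X]) ^ b) ((C t - X) ^ i))
      exact eval_eq_zero_of_dvd_of_eval_eq_zero h (by simp; omega)
    · have h := pow_sub_dvd_iterate_derivative_of_pow_dvd k
        (dvd_mul_left ((C t - X : ℝ[X]) ^ i) (X ^ b))
      exact eval_eq_zero_of_dvd_of_eval_eq_zero h (by simp; omega)
  have key : ∀ k ≤ i, ∫ y in (0 : ℝ)..t, (derivative^[i] P).eval y * f 0 y =
      (-1) ^ k * ∫ y in (0 : ℝ)..t, (derivative^[i - k] P).eval y * f k y := by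
    intro k
    induction k with
    | zero => intro _; simp
    | succ k ih =>
      intro hk
      rw [ih (by omega)]
      obtain ⟨l, hl⟩ : ∃ l, i - k = l + 1 := ⟨i - k - 1, by omega⟩
      have hl' : i - (k + 1) = l := by omega
      have hparts := intervalIntegral.integral_mul_deriv_eq_deriv_mul (a := 0) (b := t)
        (u := f k) (u' := f (k + 1)) (v := fun y => (derivative^[l] P).eval y)
        (v' := fun y => (derivative^[l + 1] P).eval y)
        (fun y hy => hf k y (by rwa [Set.uIcc_of_le ht] at hy))
        (fun y _ => by
          rw [Function.iterate_succ_apply']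
          exact (derivative^[l] P).hasDerivAt y)
        (hcont (k + 1)).intervalIntegrable ((derivative^[l + 1] P).continuous.intervalIntegrable _ _)
      rw [(hz l (by omega)).1, (hz l (by omega)).2] at hparts
      simp only [mul_zero, sub_self, zero_sub] at hparts
      simp only [mul_comm (eval _ _)] at hparts ⊢
      rw [hl, hl', hparts, pow_succ]
      ring
  rw [key i le_rfl]
  simp [hP]

/-- Euler's integral `∫₀ᵗ y^a (t-y)^b (1-cy)^{-(a+b+2)} dy`. -/
theorem integral_pow_mul_sub_pow_div {t c : ℝ} (ht : 0 ≤ t) (hc : 0 ≤ c) (hct : c * t < 1)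
    (a b : ℕ) :
    ∫ y in (0 : ℝ)..t, y ^ a * (t - y) ^ b * ((1 - c * y) ^ (a + b + 2))⁻¹ =
      t ^ (a + b + 1) / (1 - c * t) ^ (a + 1) *
        (a.factorial * b.factorial / (a + b + 1).factorial) := by
  have hpos : ∀ y ∈ Set.uIcc 0 t, 0 < 1 - c * y := by
    intro y hy
    rw [Set.uIcc_of_le ht] at hy
    nlinarith [mul_le_mul_of_nonneg_left hy.2 hc]
  have hint : ∀ a b n : ℕ, IntervalIntegrable
      (fun y => y ^ a * (t - y) ^ b * ((1 - c * y) ^ n)⁻¹) volume 0 t := by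
    intro a b n
    apply ContinuousOn.intervalIntegrable
    refine ContinuousOn.mul (by fun_prop) (ContinuousOn.inv₀ (by fun_prop) ?_)
    exact fun y hy => (pow_pos (hpos y hy) n).ne'
  have h1 : 0 < 1 - c * t := by linarith
  have hderiv : ∀ a b : ℕ, ∀ y ∈ Set.uIcc 0 t,
      HasDerivAt (fun y => (y / (1 - c * y)) ^ (a + 1) * ((t - y) / (1 - c * y)) ^ b)
        ((a + 1) * (y ^ a * (t - y) ^ b * ((1 - c * y) ^ (a + b + 2))⁻¹) -
          b * (1 - c * t) * (y ^ (a + 1) * (t - y) ^ (b - 1) * ((1 - c * y) ^ (a + b + 2))⁻¹)) y := by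
    intro a b y hy
    have h := (hpos y hy).ne'
    have hd : HasDerivAt (fun y => 1 - c * y) (-c) y := by
      simpa using ((hasDerivAt_id y).const_mul c).const_sub 1
    have h2 := (((hasDerivAt_id y).div hd h).pow (a + 1)).mul
      ((((hasDerivAt_id y).const_sub t).div hd h).pow b)
    refine h2.congr_deriv ?_
    rcases b with _ | b
    · simp only [id, Nat.add_sub_cancel, Pi.pow_apply, Pi.div_apply, div_pow, pow_zero]
      push_cast
      field_simp
      ring
    · simp only [id, Nat.add_sub_cancel, Pi.pow_apply, Pi.div_apply, div_pow]
      push_cast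
      field_simp
      ring
  induction b generalizing a with
  | zero =>
    have := intervalIntegral.integral_eq_sub_of_hasDerivAt (hderiv a 0)
      (((hint a 0 _).const_mul _).sub ((hint (a + 1) (0 - 1) _).const_mul _))
    simp only [Nat.cast_zero, zero_mul, sub_zero, intervalIntegral.integral_const_mul, pow_zero,
      mul_one, add_zero, zero_div, ne_eq, Nat.add_eq_zero_iff, one_ne_zero, and_false,
      not_false_eq_true, zero_pow] at this
    rw [mul_comm, ← eq_div_iff (by positivity)] at this
    simp only [pow_zero, mul_one, add_zero]
    rw [this, Nat.factorial_succ, div_pow]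
    push_cast
    field_simp
    simp
  | succ b ih =>
    have := intervalIntegral.integral_eq_sub_of_hasDerivAt (hderiv a (b + 1))
      (((hint a (b + 1) _).const_mul _).sub ((hint (a + 1) (b + 1 - 1) _).const_mul _))
    rw [intervalIntegral.integral_sub ((hint a (b + 1) _).const_mul _)
      ((hint (a + 1) (b + 1 - 1) _).const_mul _)] at this
    simp only [intervalIntegral.integral_const_mul, Nat.add_sub_cancel] at this
    rw [show a + (b + 1) + 2 = a + 1 + b + 2 by ring, ih (a + 1)] at this
    simp only [sub_self, zero_div, ne_eq, Nat.add_eq_zero_iff, one_ne_zero, and_false,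
      not_false_eq_true, zero_pow, mul_zero, zero_mul] at this
    rw [sub_eq_zero, mul_comm, ← eq_div_iff (by positivity)] at this
    rw [show a + (b + 1) + 2 = a + 1 + b + 2 by ring, this, Nat.factorial_succ a,
      Nat.factorial_succ b, show a + (b + 1) + 1 = a + 1 + b + 1 by ring]
    push_cast
    field_simp
    ring

open Polynomial in
/-- Pairing a Rodrigues-type polynomial with a smooth function. -/
theorem integral_rodrigues_mul {t : ℝ} (ht : 0 ≤ t) {a i : ℕ} {q : ℝ[X]}
    (hq : X ^ a * q = C ((-1) ^ i * ((a + i).factorial : ℝ) / (a + 2 * i).factorial) *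
        derivative^[i] (X ^ (a + i) * (C t - X) ^ i))
    (f : ℕ → ℝ → ℝ) (hf : ∀ k, ∀ y ∈ Set.Icc 0 t, HasDerivAt (f k) (f (k + 1) y) y) :
    ∫ y in Set.Icc 0 t, q.eval y * (y ^ a * f 0 y) =
      ((a + i).factorial : ℝ) / (a + 2 * i).factorial *
        ∫ y in (0 : ℝ)..t, y ^ (a + i) * (t - y) ^ i * f i y := by
  have hpt : ∀ y, q.eval y * (y ^ a * f 0 y) =
      (-1) ^ i * ((a + i).factorial : ℝ) / (a + 2 * i).factorial *
        ((derivative^[i] (X ^ (a + i) * (C t - X) ^ i : ℝ[X])).eval y * f 0 y) := by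
    intro y
    have h := congrArg (eval y) hq
    simp only [eval_mul, eval_pow, eval_X, eval_C] at h
    linear_combination f 0 y * h
  rw [integral_Icc_eq_integral_Ioc, ← intervalIntegral.integral_of_le ht]
  simp_rw [hpt]
  rw [intervalIntegral.integral_const_mul,
    integral_iterate_derivative_mul ht i (a + i) (Nat.le_add_left i a) f hf, ← mul_assoc]
  congr 1
  have hs : ((-1 : ℝ) ^ i) * (-1) ^ i = 1 := by rw [← mul_pow]; simp
  linear_combination ((a + i).factorial : ℝ) / (a + 2 * i).factorial * hs

open Polynomial in
theorem integral_rodrigues_mul_pow_of_lt {t : ℝ} (ht : 0 ≤ t) {a i j : ℕ} (hji : j < i) {q : ℝ[X]}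
    (hq : X ^ a * q = C ((-1) ^ i * ((a + i).factorial : ℝ) / (a + 2 * i).factorial) *
        derivative^[i] (X ^ (a + i) * (C t - X) ^ i)) :
    ∫ y in Set.Icc 0 t, q.eval y * (y ^ a * y ^ j) = 0 := by
  have h := integral_rodrigues_mul ht hq (fun k y => (derivative^[k] (X ^ j : ℝ[X])).eval y)
    (fun k y _ => by
      rw [Function.iterate_succ_apply']
      exact (derivative^[k] (X ^ j : ℝ[X])).hasDerivAt y)
  have hz : derivative^[i] (X ^ j : ℝ[X]) = 0 := iterate_derivative_eq_zero (by simpa using hji)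
  simpa [hz] using h

open Polynomial in
theorem integral_rodrigues_mul_pow_self {t : ℝ} (ht : 0 ≤ t) {a i : ℕ} {q : ℝ[X]}
    (hq : X ^ a * q = C ((-1) ^ i * ((a + i).factorial : ℝ) / (a + 2 * i).factorial) *
        derivative^[i] (X ^ (a + i) * (C t - X) ^ i)) :
    ∫ y in Set.Icc 0 t, q.eval y * (y ^ a * y ^ i) =
      t ^ (a + 2 * i + 1) * ((i.factorial * (a + i).factorial) ^ 2 /
        ((a + 2 * i).factorial * (a + 2 * i + 1).factorial)) := by
  have h := integral_rodrigues_mul ht hq (fun k y => (derivative^[k] (X ^ i : ℝ[X])).eval y)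
    (fun k y _ => by
      rw [Function.iterate_succ_apply']
      exact (derivative^[k] (X ^ i : ℝ[X])).hasDerivAt y)
  have hbeta := integral_pow_mul_sub_pow_div ht le_rfl (by simp : (0 : ℝ) * t < 1) (a + i) i
  simp only [zero_mul, sub_zero, one_pow, inv_one, mul_one, div_one] at hbeta
  have hd : derivative^[i] (X ^ i : ℝ[X]) = (i.factorial : ℝ[X]) := by
    rw [iterate_derivative_X_pow_eq_natCast_mul]
    simp [Nat.descFactorial_self]
  simp only [hd, eval_natCast,
    Function.iterate_zero, id, eval_pow, eval_X, intervalIntegral.integral_mul_const, hbeta] at h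
  rw [h, show a + i + i = a + 2 * i by ring]
  ring

open Polynomial in
theorem integral_rodrigues_mul_inv_pow {t c : ℝ} (ht : 0 ≤ t) (hc : 0 ≤ c) (hct : c * t < 1)
    {a i : ℕ} {q : ℝ[X]}
    (hq : X ^ a * q = C ((-1) ^ i * ((a + i).factorial : ℝ) / (a + 2 * i).factorial) *
        derivative^[i] (X ^ (a + i) * (C t - X) ^ i)) :
    ∫ y in Set.Icc 0 t, q.eval y * (y ^ a * ((1 - c * y) ^ (a + i + 2))⁻¹) =
      t ^ (a + 2 * i + 1) * (c ^ i / (1 - c * t) ^ (a + i + 1)) *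
        ((a + i).factorial ^ 2 * i.factorial /
          ((a + 2 * i).factorial * (a + i + 1).factorial)) := by
  have h := integral_rodrigues_mul ht hq
    (fun k y => c ^ k * ((a + i + 1 + k).factorial / (a + i + 1).factorial) *
      ((1 - c * y) ^ (a + i + 2 + k))⁻¹)
    (fun k y hy => by
      have hpos : 1 - c * y ≠ 0 := by
        have := mul_le_mul_of_nonneg_left hy.2 hc
        linarith
      have hd : HasDerivAt (fun y => 1 - c * y) (-c) y := by
        simpa using ((hasDerivAt_id y).const_mul c).const_sub 1
      have h2 := ((hd.pow (a + i + 2 + k)).inv (pow_ne_zero _ hpos)).const_mul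
        (c ^ k * (((a + i + 1 + k).factorial : ℝ) / (a + i + 1).factorial))
      refine h2.congr_deriv ?_
      rw [show a + i + 1 + (k + 1) = a + i + 1 + k + 1 by ring, Nat.factorial_succ (a + i + 1 + k),
        show a + i + 2 + k - 1 = a + i + 1 + k by omega]
      simp only [Pi.pow_apply]
      push_cast
      field_simp
      ring)
  have heuler := integral_pow_mul_sub_pow_div ht hc hct (a + i) i
  have hrw : ∀ y : ℝ, y ^ (a + i) * (t - y) ^ i *
      (c ^ i * (((a + i + 1 + i).factorial : ℝ) / (a + i + 1).factorial) *
        ((1 - c * y) ^ (a + i + 2 + i))⁻¹) =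
      c ^ i * (((a + i + 1 + i).factorial : ℝ) / (a + i + 1).factorial) *
        (y ^ (a + i) * (t - y) ^ i * ((1 - c * y) ^ (a + i + i + 2))⁻¹) := by
    intro y
    rw [show a + i + 2 + i = a + i + i + 2 by ring]
    ring
  simp_rw [hrw] at h
  rw [intervalIntegral.integral_const_mul, heuler, pow_zero, one_mul, add_zero,
    div_self (by positivity)] at h
  simp only [one_mul, add_zero] at h
  rw [h, show a + i + 1 + i = a + i + i + 1 by ring, show a + i + i = a + 2 * i by ring]
  have h1 : 1 - c * t ≠ 0 := by linarith
  field_simp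

theorem prod_range_two_mul (g : ℕ → ℝ) (m : ℕ) :
    ∏ k ∈ Finset.range (2 * m), g k = ∏ i ∈ Finset.range m, g (2 * i) * g (2 * i + 1) := by
  induction m with
  | zero => simp
  | succ m ih =>
    rw [show 2 * (m + 1) = 2 * m + 1 + 1 by ring, Finset.prod_range_succ, Finset.prod_range_succ,
      Finset.prod_range_succ, ih, mul_assoc]

theorem K1_self_add (m a : ℕ) :
    K1 m m (m + a) = ∏ i ∈ Finset.range m,
      (((a + 2 * i).factorial : ℝ) * (a + 2 * i + 1).factorial) /
        (i.factorial * (a + i).factorial) ^ 2 := by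
  have h1 : K1 m m (m + a) = ∏ i ∈ Finset.range m,
      ((a + m + i).factorial : ℝ) / (i.factorial * i.factorial * (a + i).factorial) := by
    rw [K1]
    refine Finset.prod_nbij' (fun j => m - j) (fun i => m - i) ?_ ?_ ?_ ?_ ?_
    · intro j hj
      simp only [Finset.mem_Icc, Finset.mem_range] at hj ⊢
      omega
    · intro i hi
      simp only [Finset.mem_Icc, Finset.mem_range] at hi ⊢
      omega
    · intro j hj
      simp only [Finset.mem_Icc] at hj
      omega
    · intro i hi
      simp only [Finset.mem_range] at hi
      omega
    · intro j hj
      simp only [Finset.mem_Icc] at hj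
      rw [show m + (m + a) - j = a + m + (m - j) by omega,
        show m + a - j = a + (m - j) by omega]
  have h2 := prod_range_two_mul (fun k => ((a + k).factorial : ℝ)) m
  rw [two_mul, Finset.prod_range_add] at h2
  simp only [← add_assoc] at h2
  rw [h1, Finset.prod_div_distrib, Finset.prod_div_distrib, ← h2, div_eq_div_iff]
  · have h3 : ∏ i ∈ Finset.range m, ((i.factorial : ℝ) * (a + i).factorial) ^ 2 =
        (∏ i ∈ Finset.range m, ((a + i).factorial : ℝ)) *
          ∏ i ∈ Finset.range m, ((i.factorial : ℝ) * i.factorial * (a + i).factorial) := by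
      rw [← Finset.prod_mul_distrib]
      exact Finset.prod_congr rfl fun i _ => by ring
    rw [h3]
    ring
  · exact Finset.prod_ne_zero_iff.2 fun i _ => by positivity
  · exact Finset.prod_ne_zero_iff.2 fun i _ => by positivity

theorem prod_range_pow_odd (t : ℝ) (a m : ℕ) :
    ∏ i ∈ Finset.range m, t ^ (a + 2 * i + 1) = t ^ (m * (m + a)) := by
  induction m with
  | zero => simp
  | succ m ih =>
    rw [Finset.prod_range_succ, ih, ← pow_add]
    congr 1
    ring

/-- Integrating a squared Vandermonde determinant against a divided difference, for the Jacobi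
weight `y ^ a` on `[0, t]`. -/
theorem setIntegral_vdm_sq_mul_sum {n a : ℕ} {c t : ℝ} (ht : 0 ≤ t) (hc : 0 ≤ c) (hct : c * t < 1) :
    ∫ x in orderedRegion (n + 1) t, vdm x ^ 2 * (∏ j, x j ^ a) *
        ∑ k, (∏ j ∈ Finset.univ.erase k, (x k - x j))⁻¹ * ((1 - c * x k) ^ (a + n + 2))⁻¹ =
      (∏ i ∈ Finset.range n, t ^ (a + 2 * i + 1) * (((i.factorial : ℝ) * (a + i).factorial) ^ 2 /
        ((a + 2 * i).factorial * (a + 2 * i + 1).factorial))) *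
      (t ^ (a + 2 * n + 1) * (c ^ n / (1 - c * t) ^ (a + n + 1)) *
        ((a + n).factorial ^ 2 * n.factorial /
          ((a + 2 * n).factorial * (a + n + 1).factorial))) := by
  choose q hdeg hmonic hq using fun i => exists_monic_rodrigues a i t
  let f : ℝ → ℝ := fun y => ((1 - c * y) ^ (a + n + 2))⁻¹
  let A : Fin (n + 1) → ℝ → ℝ := fun i y => (q i).eval y
  let B : Fin (n + 1) → ℝ → ℝ := fun i y =>
    y ^ a * (if i = Fin.last n then f y else y ^ (i : ℕ))
  have hf : ContinuousOn f (Set.Icc 0 t) := by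
    refine ContinuousOn.inv₀ (by fun_prop) fun y hy => pow_ne_zero _ ?_
    have := mul_le_mul_of_nonneg_left hy.2 hc
    linarith
  have hAB : ∀ i j, IntegrableOn (fun y => A i y * B j y) (Set.Icc 0 t) := by
    intro i j
    refine ContinuousOn.integrableOn_Icc ((q i).continuous.continuousOn.mul
      ((continuous_pow a).continuousOn.mul ?_))
    split_ifs
    · exact hf
    · exact (continuous_pow _).continuousOn
  have hdet : ∀ᵐ x ∂(volume.restrict (orderedRegion (n + 1) t)),
      vdm x ^ 2 * (∏ j, x j ^ a) *
        ∑ k, (∏ j ∈ Finset.univ.erase k, (x k - x j))⁻¹ * ((1 - c * x k) ^ (a + n + 2))⁻¹ =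
      (Matrix.of fun i j => A i (x j)).det * (Matrix.of fun i j => B i (x j)).det := by
    filter_upwards [ae_restrict_of_ae (ae_injective_pi (n + 1))] with x hx
    have h1 := vdm_eq_det_eval x (fun i => q i) (fun i => hdeg i) (fun i => hmonic i)
    have h2 := vdm_mul_sum_eq_det x hx f
    have h3 := Matrix.det_mul_row (fun j => x j ^ a)
      (Matrix.of fun i j : Fin (n + 1) => if i = Fin.last n then f (x j) else x j ^ (i : ℕ))
    simp only [Matrix.of_apply] at h3
    rw [← h1, h3, ← h2]
    ring
  rw [integral_congr_ae hdet, setIntegral_orderedRegion_det_mul_det A B hAB,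
    Matrix.det_of_isUpperTriangular]
  · simp only [Matrix.of_apply]
    rw [Fin.prod_univ_castSucc, ← Fin.prod_univ_eq_prod_range
      (fun i => t ^ (a + 2 * i + 1) * (((i.factorial : ℝ) * (a + i).factorial) ^ 2 /
        ((a + 2 * i).factorial * (a + 2 * i + 1).factorial)))]
    congr 1
    · refine Finset.prod_congr rfl fun i _ => ?_
      rw [← integral_rodrigues_mul_pow_self ht (hq i)]
      simp [A, B, (Fin.castSucc_lt_last i).ne]
    · rw [← integral_rodrigues_mul_inv_pow ht hc hct (hq n)]
      simp [A, B, f]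
  · intro i j hji
    have hlt : j < i := hji
    have hj : j ≠ Fin.last n := (hlt.trans_le (Fin.le_last i)).ne
    simpa [A, B, hj] using integral_rodrigues_mul_pow_of_lt ht (Fin.lt_def.1 hlt) (hq i)

/-- Selberg-type integral identity: the c.d.f. at `t` of the largest eigenvalue of the
rank-one deformed Jacobi unitary ensemble in the balanced case `n = m`. -/
theorem cdf_balanced_deformed_JUE (m p : ℕ) (hm : 1 ≤ m) (hmp : m ≤ p)
    (η : ℝ) (hη : 0 < η) (t : ℝ) (ht0 : 0 < t) (ht1 : t ≤ 1) :
    (K1 m m p * K2 m m p / (η ^ (m - 1) * (1 + η) ^ (p + 1 - m))) *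
      (∫ x in orderedRegion m t,
        vdm x ^ 2 * (∏ j, x j ^ (p - m)) *
          ∑ k : Fin m, (∏ j ∈ Finset.univ.erase k, (x k - x j))⁻¹ *
            ((1 - η / (1 + η) * x k) ^ (p + 1))⁻¹)
    = t ^ (m * p) / (1 + η * (1 - t)) ^ p := by
  obtain ⟨n, rfl⟩ := Nat.exists_eq_add_of_le' hm
  obtain ⟨a, rfl⟩ := Nat.exists_eq_add_of_le hmp
  have hpos : 0 < 1 + η := by linarith
  have hs : 0 < 1 + η * (1 - t) := by nlinarith
  have hct : 1 - η / (1 + η) * t = (1 + η * (1 - t)) / (1 + η) := by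
    field_simp
    ring
  have hlt : η / (1 + η) * t < 1 := by
    have := div_pos hs hpos
    linarith
  have hint := setIntegral_vdm_sq_mul_sum (n := n) (a := a) ht0.le (div_pos hη hpos).le hlt
  rw [show n + 1 + a - (n + 1) = a by omega, show n + 1 + a + 1 = a + n + 2 by ring,
    show a + n + 2 - (n + 1) = a + 1 by omega, hint, Nat.add_sub_cancel, K1_self_add,
    Finset.prod_range_succ, ← prod_range_pow_odd, Finset.prod_range_succ,
    Finset.prod_mul_distrib, hct, K2, show n + 1 - 1 = n by omega,
    show n + 1 + (n + 1 + a) - (n + 1) = a + n + 1 by omega,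
    show n + 1 + (n + 1 + a) - 1 = a + 2 * n + 1 by omega,
    show n + 1 + a = a + n + 1 by ring]
  have hprod : (∏ i ∈ Finset.range n, (((a + 2 * i).factorial : ℝ) * (a + 2 * i + 1).factorial) /
      (i.factorial * (a + i).factorial) ^ 2) *
      (∏ i ∈ Finset.range n, ((i.factorial : ℝ) * (a + i).factorial) ^ 2 /
        ((a + 2 * i).factorial * (a + 2 * i + 1).factorial)) = 1 := by
    rw [← Finset.prod_mul_distrib]
    refine Finset.prod_eq_one fun i _ => ?_
    field_simp
  generalize (∏ i ∈ Finset.range n, t ^ (a + 2 * i + 1)) = T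
  have hK := eq_inv_of_mul_eq_one_left hprod
  have hne := right_ne_zero_of_mul_eq_one hprod
  rw [hK]
  generalize (∏ i ∈ Finset.range n, ((i.factorial : ℝ) * (a + i).factorial) ^ 2 /
        ((a + 2 * i).factorial * (a + 2 * i + 1).factorial)) = P at hne
  rw [div_pow, div_pow]
  field_simp
  ring
end

section
/- For all integers n, p, m with 1 ≤ m ≤ min(n,p), setting α = n − m and β = p − m, for every real t ∈ (0,1] one has 𝒦₁(m,n,p) · ∫_{0 ≤ x₁ ≤ ⋯ ≤ x_m ≤ t} Δ_m(x)² · ∏_{j=1}^m x_j^{β} (1 − x_j)^{α} dx₁⋯dx_m = 𝒦(m,p,α) · ((n+p−1)! / (m+p−1)!) · t^{m(α+β+m)} · det[ (m+i+β)_{j−1} · P_{m+i−j}^{(j−1, β+j−1)}(2/t − 1) ]_{i,j = 1,…,α}, where the determinant of the empty (α = 0) matrix is 1. (This is the c.d.f. at t of the largest eigenvalue of the undeformed Jacobi unitary ensemble.) -/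
open MeasureTheory Finset

/-- `𝒦(m,p,α) = ∏_{j=0}^{α−1} (p+m+j−1)!/(p+m+2j)!`. -/
noncomputable def Kc (m p α : ℕ) : ℝ :=
  ∏ j ∈ Finset.range α, (Nat.factorial (p + m + j - 1) : ℝ) / (Nat.factorial (p + m + 2 * j) : ℝ)

/-- Pochhammer symbol `(a)_k = a(a+1)⋯(a+k−1)`. -/
noncomputable def poch (a : ℝ) (k : ℕ) : ℝ := ∏ i ∈ Finset.range k, (a + i)

/-- Jacobi polynomial `P_d^{(a,b)}(x)`, with the convention `P_d^{(a,b)} = 0` for `d < 0`. -/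
noncomputable def jacobiP (d : ℤ) (a b : ℕ) (x : ℝ) : ℝ :=
  if 0 ≤ d then
    ∑ k ∈ Finset.range (d.toNat + 1),
      ((d.toNat + a).choose (d.toNat - k) : ℝ) * ((d.toNat + k + a + b).choose k : ℝ) *
        ((x - 1) / 2) ^ k
  else 0

theorem isCompact_orderedRegion (m : ℕ) (t : ℝ) : IsCompact (orderedRegion m t) := by
  have hsub : orderedRegion m t ⊆ Set.univ.pi fun _ => Set.Icc 0 t :=
    fun x hx i _ => ⟨hx.2.1 i, hx.2.2 i⟩
  refine (isCompact_univ_pi fun _ => isCompact_Icc).of_isClosed_subset ?_ hsub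
  simp only [orderedRegion, Set.ofPred_and, Set.ofPred_forall]
  refine IsClosed.inter ?_ (IsClosed.inter ?_ ?_)
  · exact isClosed_iInter fun i => isClosed_iInter fun j => isClosed_iInter fun _ =>
      isClosed_le (continuous_apply i) (continuous_apply j)
  · exact isClosed_iInter fun i => isClosed_le continuous_const (continuous_apply i)
  · exact isClosed_iInter fun i => isClosed_le (continuous_apply i) continuous_const

theorem piCongrLeft_symm_eq_comp {m : ℕ} (σ : Equiv.Perm (Fin m)) :
    ⇑(MeasurableEquiv.piCongrLeft (fun _ : Fin m => ℝ) σ.symm) = fun x => x ∘ σ := by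
  funext x
  ext i
  have := Equiv.piCongrLeft_apply_apply (fun _ : Fin m => ℝ) σ.symm x (σ i)
  rwa [Equiv.symm_apply_apply] at this

theorem measurePreserving_comp_perm {m : ℕ} (σ : Equiv.Perm (Fin m)) :
    MeasurePreserving (fun x : Fin m → ℝ => x ∘ σ) := by
  rw [← piCongrLeft_symm_eq_comp]
  exact volume_measurePreserving_piCongrLeft (fun _ : Fin m => ℝ) σ.symm

theorem measurableEmbedding_comp_perm {m : ℕ} (σ : Equiv.Perm (Fin m)) :
    MeasurableEmbedding (fun x : Fin m → ℝ => x ∘ σ) := by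
  rw [← piCongrLeft_symm_eq_comp]
  exact MeasurableEquiv.measurableEmbedding _

theorem indicator_cube_eq_sum_perm {m : ℕ} {t : ℝ} {F : (Fin m → ℝ) → ℝ}
    (hF : ∀ (σ : Equiv.Perm (Fin m)) x, F (x ∘ σ) = F x) {x : Fin m → ℝ}
    (hx : Function.Injective x) :
    (Set.univ.pi fun _ => Set.Icc 0 t).indicator F x =
      ∑ σ : Equiv.Perm (Fin m), (orderedRegion m t).indicator F (x ∘ σ) := by
  by_cases hc : x ∈ Set.univ.pi fun _ => Set.Icc 0 t
  · rw [Set.indicator_of_mem hc, Finset.sum_eq_single (Tuple.sort x)]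
    · rw [Set.indicator_of_mem, hF]
      exact ⟨fun i j hij => Tuple.monotone_sort x hij, fun i => (hc _ trivial).1,
        fun i => (hc _ trivial).2⟩
    · intro σ _ hσ
      refine Set.indicator_of_notMem (fun hmem => hσ ?_) _
      rw [Tuple.eq_sort_iff]
      exact ⟨fun i j hij => hmem.1 i j hij,
        fun i j hij h => absurd (σ.injective (hx h)) hij.ne⟩
    · simp
  · rw [Set.indicator_of_notMem hc, Finset.sum_eq_zero]
    intro σ _
    refine Set.indicator_of_notMem (fun hmem => hc fun i _ => ?_) _
    have h0 := hmem.2.1 (σ.symm i)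
    have h1 := hmem.2.2 (σ.symm i)
    simp only [Function.comp_apply, Equiv.apply_symm_apply] at h0 h1
    exact ⟨h0, h1⟩

theorem setIntegral_cube_eq_factorial_mul {m : ℕ} (t : ℝ) {F : (Fin m → ℝ) → ℝ}
    (hFc : Continuous F) (hF : ∀ (σ : Equiv.Perm (Fin m)) x, F (x ∘ σ) = F x) :
    ∫ x in Set.univ.pi fun _ => Set.Icc 0 t, F x =
      (m.factorial : ℝ) * ∫ x in orderedRegion m t, F x := by
  have hmeas : MeasurableSet (orderedRegion m t) := (isCompact_orderedRegion m t).measurableSet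
  have hint : Integrable ((orderedRegion m t).indicator F) :=
    (integrable_indicator_iff hmeas).2
      (hFc.continuousOn.integrableOn_compact (isCompact_orderedRegion m t))
  rw [← integral_indicator (MeasurableSet.univ_pi fun _ => measurableSet_Icc),
    ← integral_indicator hmeas]
  have hae := (ae_injective_pi m).mono fun x hx => indicator_cube_eq_sum_perm (t := t) hF hx
  have hint' : ∀ σ : Equiv.Perm (Fin m),
      Integrable fun x : Fin m → ℝ => (orderedRegion m t).indicator F (x ∘ σ) := fun σ =>
    ((measurePreserving_comp_perm σ).integrable_comp_emb (measurableEmbedding_comp_perm σ)).2 hint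
  rw [integral_congr_ae hae, integral_finsetSum _ fun σ _ => hint' σ]
  simp_rw [(measurePreserving_comp_perm _).integral_comp (measurableEmbedding_comp_perm _)]
  simp [Fintype.card_perm]

/-- **Andréief's identity** on a cube. -/
theorem setIntegral_cube_det_mul_det {m : ℕ} (t : ℝ) {f g : Fin m → ℝ → ℝ} {w : ℝ → ℝ}
    (hf : ∀ i, Continuous (f i)) (hg : ∀ i, Continuous (g i)) (hw : Continuous w) :
    ∫ x in Set.univ.pi fun _ => Set.Icc 0 t,
        (Matrix.of fun i j => f i (x j)).det * (Matrix.of fun i j => g i (x j)).det *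
          ∏ j, w (x j) =
      (m.factorial : ℝ) *
        (Matrix.of fun i k => ∫ x in Set.Icc 0 t, f i x * g k x * w x).det := by
  have hexp : ∀ x : Fin m → ℝ,
      (Matrix.of fun i j => f i (x j)).det * (Matrix.of fun i j => g i (x j)).det *
          ∏ j, w (x j) =
      ∑ σ : Equiv.Perm (Fin m), ∑ τ : Equiv.Perm (Fin m),
        ((Equiv.Perm.sign σ : ℤ) : ℝ) * ((Equiv.Perm.sign τ : ℤ) : ℝ) *
          ∏ j, (f (σ j) (x j) * g (τ j) (x j) * w (x j)) := by
    intro x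
    rw [Matrix.det_apply', Matrix.det_apply', Finset.sum_mul_sum, Finset.sum_mul]
    refine Finset.sum_congr rfl fun σ _ => ?_
    rw [Finset.sum_mul]
    refine Finset.sum_congr rfl fun τ _ => ?_
    simp only [Matrix.of_apply, Finset.prod_mul_distrib]
    ring
  have hI : ∀ σ τ : Equiv.Perm (Fin m), Integrable (fun x : Fin m → ℝ =>
      ((Equiv.Perm.sign σ : ℤ) : ℝ) * ((Equiv.Perm.sign τ : ℤ) : ℝ) *
          ∏ j, (f (σ j) (x j) * g (τ j) (x j) * w (x j)))
      (volume.restrict (Set.univ.pi fun _ => Set.Icc 0 t)) := by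
    intro σ τ
    refine ContinuousOn.integrableOn_compact (isCompact_univ_pi fun _ => isCompact_Icc)
      (Continuous.continuousOn ?_)
    fun_prop
  have hJ : ∀ σ τ : Equiv.Perm (Fin m),
      ∫ x in Set.univ.pi fun _ => Set.Icc 0 t,
        ∏ j, (f (σ j) (x j) * g (τ j) (x j) * w (x j)) =
      ∏ j, ∫ x in Set.Icc 0 t, f (σ j) x * g (τ j) x * w x := by
    intro σ τ
    rw [volume_pi, Measure.restrict_pi_pi]
    exact integral_fintype_prod_eq_prod (fun j x => f (σ j) x * g (τ j) x * w x)
  simp_rw [hexp]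
  rw [integral_finsetSum _ fun σ _ => integrable_finsetSum _ fun τ _ => hI σ τ]
  set M : Matrix (Fin m) (Fin m) ℝ :=
    Matrix.of fun i k => ∫ x in Set.Icc 0 t, f i x * g k x * w x with hM
  have hσ : ∀ σ : Equiv.Perm (Fin m),
      ∫ x in Set.univ.pi fun _ => Set.Icc 0 t, ∑ τ : Equiv.Perm (Fin m),
        ((Equiv.Perm.sign σ : ℤ) : ℝ) * ((Equiv.Perm.sign τ : ℤ) : ℝ) *
          ∏ j, (f (σ j) (x j) * g (τ j) (x j) * w (x j)) = M.det := by
    intro σ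
    rw [integral_finsetSum _ fun τ _ => hI σ τ]
    simp_rw [integral_const_mul, hJ]
    have h1 := Matrix.det_permute σ M
    have h2 : ((Equiv.Perm.sign σ : ℤ) : ℝ) * ((Equiv.Perm.sign σ : ℤ) : ℝ) = 1 := by
      rcases Int.units_eq_one_or (Equiv.Perm.sign σ) with h | h <;> simp [h]
    calc _ = ((Equiv.Perm.sign σ : ℤ) : ℝ) * (M.submatrix σ id).transpose.det := by
          rw [Matrix.det_apply', Finset.mul_sum]
          simp [hM, mul_assoc]
      _ = M.det := by rw [Matrix.det_transpose, h1, ← mul_assoc, h2, one_mul]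
  rw [Finset.sum_congr rfl fun σ _ => hσ σ]
  simp [Fintype.card_perm]

section ShiftedJacobi

open Polynomial

/-- The Jacobi polynomial `P_k^{(0,b)}(2X - 1)`, orthogonal for the weight `x ^ b` on `[0, 1]`. -/
noncomputable def shiftedJacobi (b k : ℕ) : ℝ[X] :=
  ∑ j ∈ Finset.range (k + 1), C ((k.choose j : ℝ) * ((k + b + j).choose j : ℝ)) * (X - 1) ^ j

theorem coeff_taylor_shiftedJacobi (b k : ℕ) (s : ℝ) (c : ℕ) :
    (taylor s (shiftedJacobi b k)).coeff c =
      ∑ l ∈ Finset.range (k + 1), (k.choose l : ℝ) * ((k + b + l).choose l : ℝ) *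
        ((s - 1) ^ (l - c) * (l.choose c : ℝ)) := by
  have h : ∀ l : ℕ, taylor s ((X - 1 : ℝ[X]) ^ l) = (X + C (s - 1)) ^ l := by
    intro l
    rw [taylor_pow, map_sub, taylor_X, taylor_one, C_sub, C_1, add_sub_assoc]
  simp only [shiftedJacobi, map_sum, finsetSum_coeff, taylor_mul, taylor_C, h, coeff_C_mul,
    coeff_X_add_C_pow]

theorem coeff_taylor_shiftedJacobi_of_lt {b k c : ℕ} (s : ℝ) (h : k < c) :
    (taylor s (shiftedJacobi b k)).coeff c = 0 := by
  rw [coeff_taylor_shiftedJacobi]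
  refine Finset.sum_eq_zero fun l hl => ?_
  rw [Nat.choose_eq_zero_of_lt (by grind : l < c)]
  simp

theorem coeff_taylor_shiftedJacobi_self (b k : ℕ) (s : ℝ) :
    (taylor s (shiftedJacobi b k)).coeff k = ((2 * k + b).choose k : ℝ) := by
  rw [coeff_taylor_shiftedJacobi, Finset.sum_range_succ, Finset.sum_eq_zero]
  · simp only [Nat.choose_self, Nat.sub_self, pow_zero]
    rw [show k + b + k = 2 * k + b by ring]
    simp
  · intro l hl
    rw [Nat.choose_eq_zero_of_lt (by grind : l < k)]
    simp

theorem natDegree_shiftedJacobi_le (b k : ℕ) : (shiftedJacobi b k).natDegree ≤ k := by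
  rw [← natDegree_taylor _ 0, natDegree_le_iff_coeff_eq_zero]
  exact fun c hc => coeff_taylor_shiftedJacobi_of_lt 0 hc

theorem poch_natCast_succ (a k : ℕ) :
    poch ((a + 1 : ℕ) : ℝ) k = ((a + k).factorial : ℝ) / (a.factorial : ℝ) := by
  have ha : (a.factorial : ℝ) ≠ 0 := by positivity
  rw [eq_div_iff ha]
  induction k with
  | zero => simp [poch]
  | succ k ih =>
    rw [poch, Finset.prod_range_succ, mul_right_comm, ← poch, ih, ← add_assoc, Nat.factorial_succ]
    push_cast
    ring

/-- The Taylor coefficients of `shiftedJacobi` are, up to normalisation, Jacobi polynomials. -/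
theorem poch_mul_jacobiP (b k j : ℕ) (s : ℝ) :
    poch ((k + b + 1 : ℕ) : ℝ) j * jacobiP ((k : ℤ) - j) j (b + j) (2 * s - 1) =
      (j.factorial : ℝ) * (taylor s (shiftedJacobi b k)).coeff j := by
  by_cases hjk : k < j
  · rw [coeff_taylor_shiftedJacobi_of_lt s hjk, jacobiP, if_neg (by omega)]
    simp
  obtain ⟨d, rfl⟩ := Nat.exists_eq_add_of_le (not_lt.1 hjk)
  have hd : ((j + d : ℕ) : ℤ) - j = (d : ℤ) := by push_cast; ring
  rw [coeff_taylor_shiftedJacobi, hd, jacobiP, if_pos (by positivity), Int.toNat_natCast,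
    add_assoc j d 1, Finset.sum_range_add _ j (d + 1), Finset.sum_eq_zero (s := Finset.range j), zero_add,
    Finset.mul_sum, Finset.mul_sum]
  · refine Finset.sum_congr rfl fun l hl => ?_
    have hl' : l ≤ d := by grind
    have h1 : (d + j).choose (d - l) = (j + d).choose (j + l) := by
      rw [← Nat.choose_symm_of_eq_add (by omega : d + j = (j + l) + (d - l)), add_comm]
    have h2 : ((j + d + b + (j + l)).choose (j + l) : ℝ) =
        ((j + d + b + (j + l)).factorial : ℝ) / ((j + d + b).factorial * (j + l).factorial) := by
      rw [Nat.choose_symm_of_eq_add (by omega : j + d + b + (j + l) = (j + l) + (j + d + b)),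
        Nat.cast_add_choose]
    have h3 : ((j + l).choose j : ℝ) = ((j + l).factorial : ℝ) / (j.factorial * l.factorial) :=
      Nat.cast_add_choose ℝ
    have h4 : ((d + l + j + (b + j)).choose l : ℝ) =
        ((j + d + b + (j + l)).factorial : ℝ) / (l.factorial * (j + d + b + j).factorial) := by
      rw [show d + l + j + (b + j) = l + (j + d + b + j) by ring, Nat.cast_add_choose,
        show l + (j + d + b + j) = j + d + b + (j + l) by ring]
    rw [h1, h2, h3, h4, poch_natCast_succ, Nat.add_sub_cancel_left]
    have := Nat.cast_ne_zero (R := ℝ).2 (Nat.factorial_ne_zero j)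
    have := Nat.cast_ne_zero (R := ℝ).2 (Nat.factorial_ne_zero l)
    have := Nat.cast_ne_zero (R := ℝ).2 (Nat.factorial_ne_zero (j + l))
    have := Nat.cast_ne_zero (R := ℝ).2 (Nat.factorial_ne_zero (j + d + b))
    have := Nat.cast_ne_zero (R := ℝ).2 (Nat.factorial_ne_zero (j + d + b + j))
    field_simp
    ring
  · intro l hl
    rw [Nat.choose_eq_zero_of_lt (by grind : l < j)]
    simp

theorem integral_sub_one_pow_mul_pow (i b : ℕ) :
    ∫ x in (0 : ℝ)..1, (x - 1) ^ i * x ^ b =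
      (-1) ^ i * (i.factorial : ℝ) * b.factorial / (i + b + 1).factorial := by
  induction i generalizing b with
  | zero =>
    have : ((b.factorial : ℝ)) ≠ 0 := by positivity
    simp only [pow_zero, one_mul, integral_pow, Nat.factorial_zero, Nat.cast_one, zero_add,
      Nat.factorial_succ, one_pow]
    push_cast
    field_simp
    simp
  | succ i ih =>
    have h : ∀ x : ℝ, (x - 1) ^ (i + 1) * x ^ b =
        (x - 1) ^ i * x ^ (b + 1) - (x - 1) ^ i * x ^ b := fun x => by ring
    simp_rw [h]
    rw [intervalIntegral.integral_sub (Continuous.intervalIntegrable (by fun_prop) _ _)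
      (Continuous.intervalIntegrable (by fun_prop) _ _), ih, ih,
      show i + (b + 1) + 1 = i + b + 1 + 1 by ring, show i + 1 + b + 1 = i + b + 1 + 1 by ring,
      Nat.factorial_succ (i + b + 1), Nat.factorial_succ i, Nat.factorial_succ b]
    have : (((i + b + 1).factorial : ℝ)) ≠ 0 := by positivity
    push_cast
    field_simp
    ring

theorem integral_shiftedJacobi_mul_pow (b k l : ℕ) :
    ∫ x in (0 : ℝ)..1, (shiftedJacobi b k).eval x * x ^ (l + b) =
      ∑ j ∈ Finset.range (k + 1), (-1) ^ j * (k.choose j : ℝ) *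
        (((k + b + j).factorial : ℝ) / (k + b).factorial *
          ((l + b).factorial / (j + (l + b) + 1).factorial)) := by
  have h : ∀ x : ℝ, (shiftedJacobi b k).eval x * x ^ (l + b) =
      ∑ j ∈ Finset.range (k + 1), (k.choose j : ℝ) * ((k + b + j).choose j : ℝ) *
        ((x - 1) ^ j * x ^ (l + b)) := by
    intro x
    simp only [shiftedJacobi, eval_finsetSum, eval_mul, eval_C, eval_pow, eval_sub, eval_X,
      eval_one, Finset.sum_mul, mul_assoc]
  simp_rw [h]
  rw [intervalIntegral.integral_finsetSum
    fun j _ => Continuous.intervalIntegrable (by fun_prop) _ _]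
  refine Finset.sum_congr rfl fun j _ => ?_
  rw [intervalIntegral.integral_const_mul, integral_sub_one_pow_mul_pow,
    Nat.choose_symm_of_eq_add (by omega : k + b + j = j + (k + b)), Nat.cast_add_choose]
  have := Nat.cast_ne_zero (R := ℝ).2 (Nat.factorial_ne_zero j)
  field_simp

theorem sum_neg_one_pow_mul_choose_mul_eval {P : ℝ[X]} {k : ℕ} (hP : P.natDegree < k) :
    ∑ j ∈ Finset.range (k + 1), (-1) ^ j * (k.choose j : ℝ) * P.eval (j : ℝ) = 0 := by
  have h := congrFun (fwdDiff_iter_eq_zero_of_degree_lt hP) 0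
  rw [fwdDiff_iter_eq_sum_shift] at h
  have h2 : ∑ j ∈ Finset.range (k + 1), (-1) ^ j * (k.choose j : ℝ) * P.eval (j : ℝ) =
      (-1) ^ k * ∑ j ∈ Finset.range (k + 1),
        ((-1 : ℤ) ^ (k - j) * (k.choose j : ℤ)) • P.eval (0 + j • (1 : ℝ)) := by
    rw [Finset.mul_sum]
    refine Finset.sum_congr rfl fun j hj => ?_
    obtain ⟨r, rfl⟩ := Nat.exists_eq_add_of_le (by grind : j ≤ k)
    have hr : ((-1 : ℝ) ^ r) * (-1) ^ r = 1 := by rw [← mul_pow]; simp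
    simp only [zsmul_eq_mul, zero_add, nsmul_eq_mul, mul_one, Nat.add_sub_cancel_left, pow_add]
    push_cast
    linear_combination (-(-1) ^ j * ((j + r).choose j : ℝ) * P.eval (j : ℝ)) * hr
  rw [h2, h]
  simp

theorem integral_shiftedJacobi_mul_pow_of_lt {b k l : ℕ} (h : l < k) :
    ∫ x in (0 : ℝ)..1, (shiftedJacobi b k).eval x * x ^ (l + b) = 0 := by
  obtain ⟨r, rfl⟩ := Nat.exists_eq_add_of_lt h
  let P : ℝ[X] := C (((l + b).factorial : ℝ) / (l + r + 1 + b).factorial) *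
    (ascPochhammer ℝ r).comp (X + C ((l + b + 1 + 1 : ℕ) : ℝ))
  have hP : P.natDegree < l + r + 1 := by
    refine (natDegree_C_mul_le _ _).trans_lt ?_
    rw [natDegree_comp, ascPochhammer_natDegree, natDegree_X_add_C]
    omega
  rw [integral_shiftedJacobi_mul_pow, ← sum_neg_one_pow_mul_choose_mul_eval hP]
  refine Finset.sum_congr rfl fun j _ => ?_
  congr 1
  have h1 : (ascPochhammer ℝ r).eval ((j + (l + b) + 1 + 1 : ℕ) : ℝ) =
      ((j + (l + b) + 1 + r).factorial : ℝ) / (j + (l + b) + 1).factorial := by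
    rw [← ascPochhammer_eval_cast, ascPochhammer_nat_eq_ascFactorial, eq_div_iff (by positivity),
      mul_comm]
    exact_mod_cast Nat.factorial_mul_ascFactorial _ r
  simp only [P, eval_mul, eval_C, eval_comp, eval_add, eval_X]
  rw [show (j : ℝ) + ((l + b + 1 + 1 : ℕ) : ℝ) = ((j + (l + b) + 1 + 1 : ℕ) : ℝ) by
    push_cast; ring, h1, show l + r + 1 + b + j = j + (l + b) + 1 + r by ring]
  field_simp

theorem integral_shiftedJacobi_mul_pow_self (b k : ℕ) :
    ∫ x in (0 : ℝ)..1, (shiftedJacobi b k).eval x * x ^ (k + b) =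
      (k.factorial : ℝ) * (k + b).factorial / (2 * k + b + 1).factorial := by
  have h1 := integral_sub_one_pow_mul_pow k (k + b)
  have h2 : ∀ x : ℝ, (x - 1) ^ k * x ^ (k + b) = ∑ j ∈ Finset.range (k + 1),
      (-1) ^ k * ((-1) ^ j * (k.choose j : ℝ)) * x ^ (j + (k + b)) := by
    intro x
    rw [show x - 1 = (-1) * (-x + 1) by ring, mul_pow, add_pow, Finset.mul_sum, Finset.sum_mul]
    refine Finset.sum_congr rfl fun j _ => ?_
    rw [neg_pow x, one_pow, pow_add]
    ring
  simp_rw [h2] at h1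
  rw [intervalIntegral.integral_finsetSum
    fun j _ => Continuous.intervalIntegrable (by fun_prop) _ _] at h1
  simp_rw [intervalIntegral.integral_const_mul, integral_pow, mul_assoc] at h1
  rw [← Finset.mul_sum, mul_div_assoc] at h1
  have h3 := mul_left_cancel₀ (by simp) h1
  rw [integral_shiftedJacobi_mul_pow, show 2 * k + b + 1 = k + (k + b) + 1 by ring, mul_div_assoc]
  rw [mul_div_assoc] at h3
  rw [← h3]
  refine Finset.sum_congr rfl fun j _ => ?_
  rw [show k + b + j = j + (k + b) by ring, Nat.factorial_succ (j + (k + b))]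
  have := Nat.cast_ne_zero (R := ℝ).2 (Nat.factorial_ne_zero (j + (k + b)))
  push_cast
  field_simp
  simp

end ShiftedJacobi

section BlockDeterminant

open Polynomial

theorem coe_finRotate_pow (N a : ℕ) (x : Fin N) :
    (((finRotate N ^ a) x : Fin N) : ℕ) = (x + a) % N := by
  obtain ⟨N, rfl⟩ := Nat.exists_eq_succ_of_ne_zero (Fin.pos x).ne'
  induction a with
  | zero => simp [Nat.mod_eq_of_lt x.isLt]
  | succ a ih =>
    rw [pow_succ', Equiv.Perm.mul_apply, finRotate_apply, Fin.val_add, ih, Fin.val_one']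
    simp [add_assoc]

theorem neg_one_pow_rotate {m : ℕ} (hm : 1 ≤ m) (a : ℕ) :
    ((-1 : ℝ) ^ (m + a - 1)) ^ a = ((-1) ^ a) ^ m := by
  obtain ⟨r, rfl⟩ := Nat.exists_eq_add_of_le' hm
  rw [← pow_mul, ← pow_mul, show r + 1 + a - 1 = r + a by omega]
  refine neg_one_pow_congr ?_
  simp only [Nat.even_mul, Nat.even_add, Nat.even_add_one]
  tauto

/-- The Taylor coefficient matrix of polynomials of degree at most their index, with the first `a`
columns moved to the end. -/
theorem det_taylor_rotate {m : ℕ} (hm : 1 ≤ m) (a : ℕ) {T : ℕ → ℕ → ℝ}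
    (hT : ∀ k c, k < c → T k c = 0) :
    (Matrix.of fun (r c : Fin m ⊕ Fin a) =>
        T (Sum.elim (fun i : Fin m => (i : ℕ)) (fun j : Fin a => m + j) r)
          (Sum.elim (fun i : Fin m => a + (i : ℕ)) (fun j : Fin a => (j : ℕ)) c)).det =
      ((-1) ^ a) ^ m * ∏ k ∈ Finset.range (m + a), T k k := by
  have h : (Matrix.of fun (r c : Fin m ⊕ Fin a) =>
        T (Sum.elim (fun i : Fin m => (i : ℕ)) (fun j : Fin a => m + j) r)
          (Sum.elim (fun i : Fin m => a + (i : ℕ)) (fun j : Fin a => (j : ℕ)) c)) =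
      ((Matrix.of fun k c : Fin (m + a) => T k c).submatrix id (finRotate (m + a) ^ a)).submatrix
        finSumFinEquiv finSumFinEquiv := by
    ext r c
    rcases r with r | r <;> rcases c with c | c <;>
      simp only [Matrix.of_apply, Matrix.submatrix_apply, id, coe_finRotate_pow, Sum.elim_inl,
        Sum.elim_inr, finSumFinEquiv_apply_left, finSumFinEquiv_apply_right, Fin.val_castAdd,
        Fin.val_natAdd]
    all_goals congr 1
    · rw [Nat.mod_eq_of_lt (by omega), add_comm]
    · rw [add_right_comm, Nat.add_mod_left, Nat.mod_eq_of_lt (by omega)]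
    · rw [Nat.mod_eq_of_lt (by omega), add_comm]
    · rw [add_right_comm, Nat.add_mod_left, Nat.mod_eq_of_lt (by omega)]
  have hlow : (Matrix.of fun k c : Fin (m + a) => T k c).IsLowerTriangular :=
    fun i j hij => hT i j hij
  rw [h, Matrix.det_submatrix_equiv_self, Matrix.det_permute', map_pow, sign_finRotate,
    Matrix.det_of_isLowerTriangular _ hlow, ← neg_one_pow_rotate hm,
    ← Fin.prod_univ_eq_prod_range]
  push_cast
  rfl

theorem eval_eq_sum_taylor {f : ℝ[X]} {N : ℕ} (hf : f.natDegree < N) (s x : ℝ) :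
    f.eval x = ∑ c ∈ Finset.range N, (taylor s f).coeff c * (x - s) ^ c := by
  rw [← taylor_eval_sub s f x, eval_eq_sum_range' (by rwa [natDegree_taylor])]

theorem det_moment_mul_prod_choose {m : ℕ} (hm : 1 ≤ m) (a b : ℕ) (s : ℝ) :
    ((-1) ^ a) ^ m * (∏ k ∈ Finset.range (m + a), ((2 * k + b).choose k : ℝ)) *
        (Matrix.of fun i l : Fin m =>
          ∫ x in (0 : ℝ)..1, (x - s) ^ (a + (i : ℕ)) * x ^ ((l : ℕ) + b)).det =
      (∏ k ∈ Finset.range m,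
        ((k.factorial : ℝ) * (k + b).factorial / (2 * k + b + 1).factorial)) *
        (Matrix.of fun i j : Fin a => (taylor s (shiftedJacobi b (m + i))).coeff j).det := by
  set T : ℕ → ℕ → ℝ := fun k c => (taylor s (shiftedJacobi b k)).coeff c with hT
  let μ : ℕ → ℕ → ℝ := fun c l => ∫ x in (0 : ℝ)..1, (x - s) ^ c * x ^ (l + b)
  let H : ℕ → ℕ → ℝ := fun k l => ∫ x in (0 : ℝ)..1, (shiftedJacobi b k).eval x * x ^ (l + b)
  have hB := det_taylor_rotate hm a (T := T)
    fun k c hkc => coeff_taylor_shiftedJacobi_of_lt s hkc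
  simp only [hT, coeff_taylor_shiftedJacobi_self] at hB
  rw [← hB]
  have hexp : ∀ k l, k < m + a → H k l = ∑ i : Fin m, T k (a + i) * μ (a + i) l +
      ∑ j : Fin a, T k j * μ j l := by
    intro k l hk
    have hk' : (shiftedJacobi b k).natDegree < a + m :=
      (natDegree_shiftedJacobi_le b k).trans_lt (by omega)
    simp only [H, eval_eq_sum_taylor hk' s, Finset.sum_mul, mul_assoc]
    rw [intervalIntegral.integral_finsetSum
      fun j _ => Continuous.intervalIntegrable (by fun_prop) _ _]
    simp only [intervalIntegral.integral_const_mul]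
    rw [Finset.sum_range_add, add_comm, ← Fin.sum_univ_eq_sum_range
      (fun i => T k (a + i) * μ (a + i) l), ← Fin.sum_univ_eq_sum_range (fun j => T k j * μ j l)]
  have hmul : (Matrix.of fun (r c : Fin m ⊕ Fin a) =>
        T (Sum.elim (fun i : Fin m => (i : ℕ)) (fun j : Fin a => m + j) r)
          (Sum.elim (fun i : Fin m => a + (i : ℕ)) (fun j : Fin a => (j : ℕ)) c)) *
      Matrix.fromBlocks (Matrix.of fun i l : Fin m => μ (a + i) l) 0
        (Matrix.of fun (j : Fin a) (l : Fin m) => μ j l) 1 =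
      Matrix.fromBlocks (Matrix.of fun k l : Fin m => H k l)
        (Matrix.of fun (k : Fin m) (j : Fin a) => T k j) 0
        (Matrix.of fun k j : Fin a => T (m + k) j) := by
    ext r c
    rcases r with r | r <;> rcases c with c | c <;>
      simp only [Matrix.mul_apply, Fintype.sum_sum_type, Matrix.of_apply, Sum.elim_inl,
        Sum.elim_inr, Matrix.fromBlocks_apply₁₁, Matrix.fromBlocks_apply₁₂,
        Matrix.fromBlocks_apply₂₁, Matrix.fromBlocks_apply₂₂, Matrix.zero_apply]
    · rw [hexp _ _ (by omega)]
    · simp [Matrix.one_apply]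
    · rw [← hexp _ _ (by omega)]
      exact integral_shiftedJacobi_mul_pow_of_lt (by omega)
    · simp [Matrix.one_apply]
  have hdet := congrArg Matrix.det hmul
  rw [Matrix.det_mul, Matrix.det_fromBlocks_zero₁₂, Matrix.det_fromBlocks_zero₂₁, Matrix.det_one,
    mul_one] at hdet
  have hH : (Matrix.of fun k l : Fin m => H k l).det = ∏ k ∈ Finset.range m,
      ((k.factorial : ℝ) * (k + b).factorial / (2 * k + b + 1).factorial) := by
    have hup : (Matrix.of fun k l : Fin m => H k l).IsUpperTriangular :=
      fun k l hkl => integral_shiftedJacobi_mul_pow_of_lt (by simpa using hkl)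
    rw [Matrix.det_of_isUpperTriangular hup,
      ← Fin.prod_univ_eq_prod_range]
    exact Finset.prod_congr rfl fun k _ => integral_shiftedJacobi_mul_pow_self b k
  rw [hH] at hdet
  exact hdet

end BlockDeterminant

theorem K1_eq_prod_range (m a b : ℕ) :
    K1 m (m + a) (m + b) = ∏ k ∈ Finset.range m, ((m + a + b + k).factorial : ℝ) /
      ((k.factorial : ℝ) * ((k + a).factorial : ℝ) * ((k + b).factorial : ℝ)) := by
  rw [K1]
  refine Finset.prod_bij' (fun j _ => m - j) (fun k _ => m - k) ?_ ?_ ?_ ?_ ?_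
  · grind
  · grind
  · grind
  · grind
  · intro j hj
    have hj' := Finset.mem_Icc.1 hj
    rw [show m + a + (m + b) - j = m + a + b + (m - j) by omega,
      show m + a - j = m - j + a by omega, show m + b - j = m - j + b by omega]

theorem prod_factorial_telescope (m b : ℕ) :
    ∏ k ∈ Finset.range m, ((m + b + k).factorial : ℝ) * (k + b).factorial =
      ∏ k ∈ Finset.range m, ((2 * k + b).factorial : ℝ) * (2 * k + b + 1).factorial := by
  have h1 := Finset.prod_range_add (fun k => ((k + b).factorial : ℝ)) m m
  have h2 : ∀ m, ∏ k ∈ Finset.range (m + m), ((k + b).factorial : ℝ) =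
      ∏ k ∈ Finset.range m, ((2 * k + b).factorial : ℝ) * (2 * k + b + 1).factorial := by
    intro m
    induction m with
    | zero => simp
    | succ m ih =>
      rw [show m + 1 + (m + 1) = m + m + 1 + 1 by ring, Finset.prod_range_succ,
        Finset.prod_range_succ, ih, Finset.prod_range_succ, show m + m + 1 + b = 2 * m + b + 1 by ring,
        show m + m + b = 2 * m + b by ring, mul_assoc]
  rw [← h2, h1, Finset.prod_mul_distrib, mul_comm]
  congr 1
  refine Finset.prod_congr rfl fun k _ => by rw [add_right_comm]

theorem prod_factorial_shift (m c : ℕ) :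
    ∏ k ∈ Finset.range m, ((k + c + 1 : ℕ) : ℝ) = ((m + c).factorial : ℝ) / c.factorial := by
  rw [eq_div_iff (by positivity)]
  induction m with
  | zero => simp
  | succ m ih =>
    rw [Finset.prod_range_succ, mul_right_comm, ih, show m + 1 + c = m + c + 1 by ring,
      Nat.factorial_succ]
    push_cast
    ring

theorem K1_mul_prod_eq {m : ℕ} (hm : 1 ≤ m) (a b : ℕ) :
    K1 m (m + a) (m + b) * ∏ k ∈ Finset.range m,
        ((k.factorial : ℝ) * (k + b).factorial / (2 * k + b + 1).factorial) =
      Kc m (m + b) a * (((m + a + (m + b) - 1).factorial : ℝ) / (m + (m + b) - 1).factorial) *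
        (∏ j ∈ Finset.range a, (j.factorial : ℝ)) *
        ∏ k ∈ Finset.range (m + a), ((2 * k + b).choose k : ℝ) := by
  have hch : ∀ k : ℕ, ((2 * k + b).choose k : ℝ) =
      ((2 * k + b).factorial : ℝ) / (k.factorial * (k + b).factorial) := by
    intro k
    rw [show 2 * k + b = k + (k + b) by ring, Nat.cast_add_choose]
  rw [K1_eq_prod_range, ← Finset.prod_mul_distrib]
  have hL : ∀ a : ℕ, ∀ k : ℕ, ((m + a + b + k).factorial : ℝ) /
      ((k.factorial : ℝ) * ((k + a).factorial : ℝ) * ((k + b).factorial : ℝ)) *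
      ((k.factorial : ℝ) * (k + b).factorial / (2 * k + b + 1).factorial) =
      ((m + a + b + k).factorial : ℝ) / ((k + a).factorial * (2 * k + b + 1).factorial) := by
    intro a k
    field_simp
  simp_rw [hL]
  induction a with
  | zero =>
    have h := prod_factorial_telescope m b
    have h0 : (((m + 0 + (m + b) - 1).factorial : ℝ) / (m + (m + b) - 1).factorial) = 1 := by
      rw [add_zero]; exact div_self (by positivity)
    rw [h0]
    simp only [Kc, Finset.range_zero, Finset.prod_empty, one_mul, mul_one, add_zero, hch]
    rw [Finset.prod_div_distrib, Finset.prod_div_distrib,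
      div_eq_div_iff (Finset.prod_ne_zero_iff.2 fun k _ => by positivity)
        (Finset.prod_ne_zero_iff.2 fun k _ => by positivity)]
    simp only [Finset.prod_mul_distrib] at h ⊢
    linear_combination (∏ k ∈ Finset.range m, (k.factorial : ℝ)) * h
  | succ a ih =>
    have hstep : ∏ k ∈ Finset.range m, ((m + (a + 1) + b + k).factorial : ℝ) /
          ((k + (a + 1)).factorial * (2 * k + b + 1).factorial) =
        (∏ k ∈ Finset.range m, ((m + a + b + k).factorial : ℝ) /
          ((k + a).factorial * (2 * k + b + 1).factorial)) *
        ((((m + (m + a + b)).factorial : ℝ) / (m + a + b).factorial) /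
          (((m + a).factorial : ℝ) / a.factorial)) := by
      rw [← prod_factorial_shift, ← prod_factorial_shift, ← Finset.prod_div_distrib,
        ← Finset.prod_mul_distrib]
      refine Finset.prod_congr rfl fun k _ => ?_
      rw [show m + (a + 1) + b + k = k + (m + a + b) + 1 by ring,
        show k + (a + 1) = k + a + 1 by ring, show m + a + b + k = k + (m + a + b) by ring,
        Nat.factorial_succ, Nat.factorial_succ (k + a)]
      push_cast
      field_simp
    obtain ⟨r, rfl⟩ := Nat.exists_eq_add_of_le' hm
    rw [hstep, ih, Kc, Kc, Finset.prod_range_succ, ← add_assoc (r + 1) a 1, Finset.prod_range_succ,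
      Finset.prod_range_succ (n := r + 1 + a), hch,
      show r + 1 + b + (r + 1) + a - 1 = 2 * r + 1 + a + b by omega,
      show r + 1 + b + (r + 1) + 2 * a = 2 * (r + 1 + a) + b by ring,
      show r + 1 + a + 1 + (r + 1 + b) - 1 = 2 * r + 1 + a + b + 1 by omega,
      show r + 1 + a + (r + 1 + b) - 1 = 2 * r + 1 + a + b by omega,
      show r + 1 + (r + 1 + a + b) = 2 * r + 1 + a + b + 1 by ring]
    have := Nat.cast_ne_zero (R := ℝ).2 (Nat.factorial_ne_zero a)
    have := Nat.cast_ne_zero (R := ℝ).2 (Nat.factorial_ne_zero (2 * r + 1 + a + b))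
    have := Nat.cast_ne_zero (R := ℝ).2 (Nat.factorial_ne_zero (2 * (r + 1 + a) + b))
    field_simp

theorem continuous_vdm (m : ℕ) : Continuous (vdm : (Fin m → ℝ) → ℝ) := by
  unfold vdm
  fun_prop

theorem vdm_eq_det_sub_one (m : ℕ) (x : Fin m → ℝ) :
    vdm x = (Matrix.of fun i j : Fin m => (x j - 1) ^ (i : ℕ)).det := by
  rw [← Matrix.det_transpose]
  change vdm x = (Matrix.vandermonde fun i => x i - 1).det
  rw [Matrix.det_vandermonde, vdm]
  refine Finset.prod_congr rfl fun i _ => Finset.prod_congr ?_ fun j _ => by ring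
  ext j
  simp

theorem vdm_eq_det (m : ℕ) (x : Fin m → ℝ) :
    vdm x = (Matrix.of fun i j : Fin m => x j ^ (i : ℕ)).det := by
  rw [← Matrix.det_transpose]
  change vdm x = (Matrix.vandermonde x).det
  rw [Matrix.det_vandermonde, vdm]
  refine Finset.prod_congr rfl fun i _ => Finset.prod_congr ?_ fun j _ => rfl
  ext j
  simp

theorem vdm_sq_comp_perm {m : ℕ} (σ : Equiv.Perm (Fin m)) (x : Fin m → ℝ) :
    vdm (x ∘ σ) ^ 2 = vdm x ^ 2 := by
  have h := Matrix.det_permute' σ (Matrix.of fun i j : Fin m => x j ^ (i : ℕ))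
  rw [← vdm_eq_det] at h
  rw [vdm_eq_det]
  change ((Matrix.of fun i j : Fin m => x j ^ (i : ℕ)).submatrix id σ).det ^ 2 = _
  rw [h, mul_pow]
  rcases Int.units_eq_one_or (Equiv.Perm.sign σ) with h | h <;> simp [h]

theorem setIntegral_Icc_sub_one_pow {t : ℝ} (ht : 0 < t) (a b i l : ℕ) :
    ∫ x in Set.Icc 0 t, (x - 1) ^ i * x ^ l * (x ^ b * (1 - x) ^ a) =
      t ^ i * (t ^ l * ((-1) ^ a * t ^ (a + b + 1) *
        ∫ x in (0 : ℝ)..1, (x - 1 / t) ^ (a + i) * x ^ (l + b))) := by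
  have h1 : ∀ x : ℝ, (x - 1) ^ i * x ^ l * (x ^ b * (1 - x) ^ a) =
      (-1) ^ a * ((x - 1) ^ (a + i) * x ^ (l + b)) := by
    intro x
    rw [show 1 - x = (-1) * (x - 1) by ring, mul_pow]
    ring
  have h2 := intervalIntegral.mul_integral_comp_mul_left (a := 0) (b := 1)
    (f := fun x : ℝ => (x - 1) ^ (a + i) * x ^ (l + b)) t
  have h3 : ∀ x : ℝ, (t * x - 1) ^ (a + i) * (t * x) ^ (l + b) =
      t ^ (a + i + l + b) * ((x - 1 / t) ^ (a + i) * x ^ (l + b)) := by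
    intro x
    rw [show t * x - 1 = t * (x - 1 / t) by field_simp, mul_pow, mul_pow]
    ring
  simp_rw [h3, intervalIntegral.integral_const_mul, mul_zero, mul_one] at h2
  simp_rw [h1]
  rw [integral_const_mul, integral_Icc_eq_integral_Ioc, ← intervalIntegral.integral_of_le ht.le,
    ← h2]
  ring

theorem prod_pow_mul_prod_pow_mul (t : ℝ) (m c : ℕ) :
    (∏ i : Fin m, t ^ (i : ℕ)) * ((∏ i : Fin m, t ^ (i : ℕ)) * (t ^ (c + 1)) ^ m) =
      t ^ (m * (c + m)) := by
  simp only [Fin.prod_univ_eq_prod_range (fun i => t ^ i)]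
  induction m with
  | zero => simp
  | succ m ih =>
    rw [Finset.prod_range_succ, show (m + 1) * (c + (m + 1)) = m * (c + m) + (m + m + (c + 1)) by ring,
      pow_add t (m * (c + m)), ← ih]
    ring

theorem setIntegral_orderedRegion_eq_det {t : ℝ} (ht : 0 < t) (m a b : ℕ) :
    ∫ x in orderedRegion m t, vdm x ^ 2 * ∏ j, x j ^ b * (1 - x j) ^ a =
      t ^ (m * (a + b + m)) * (((-1) ^ a) ^ m * (Matrix.of fun i l : Fin m =>
        ∫ x in (0 : ℝ)..1, (x - 1 / t) ^ (a + (i : ℕ)) * x ^ ((l : ℕ) + b)).det) := by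
  have hsym := setIntegral_cube_eq_factorial_mul (m := m) t
    (F := fun x => vdm x ^ 2 * ∏ j, x j ^ b * (1 - x j) ^ a)
    (((continuous_vdm m).pow 2).mul (by fun_prop)) fun σ x => by
      simp only [vdm_sq_comp_perm, Function.comp_apply]
      rw [Equiv.prod_comp σ fun j => x j ^ b * (1 - x j) ^ a]
  have hand := setIntegral_cube_det_mul_det (m := m) t (f := fun i x => (x - 1) ^ (i : ℕ))
    (g := fun i x => x ^ (i : ℕ)) (w := fun x => x ^ b * (1 - x) ^ a)
    (fun i => by fun_prop) (fun i => by fun_prop) (by fun_prop)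
  simp only [← vdm_eq_det_sub_one, ← vdm_eq_det, ← sq] at hand
  rw [hsym] at hand
  rw [mul_left_cancel₀ (by positivity) hand]
  simp_rw [setIntegral_Icc_sub_one_pow ht]
  have h1 := Matrix.det_mul_column (fun i : Fin m => t ^ (i : ℕ)) (Matrix.of fun i l : Fin m =>
    t ^ (l : ℕ) * ((-1) ^ a * t ^ (a + b + 1) *
        ∫ x in (0 : ℝ)..1, (x - 1 / t) ^ (a + (i : ℕ)) * x ^ ((l : ℕ) + b)))
  have h2 := Matrix.det_mul_row (fun i : Fin m => t ^ (i : ℕ)) (Matrix.of fun i l : Fin m =>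
    (-1) ^ a * t ^ (a + b + 1) *
        ∫ x in (0 : ℝ)..1, (x - 1 / t) ^ (a + (i : ℕ)) * x ^ ((l : ℕ) + b))
  have h3 := Matrix.det_smul (Matrix.of fun i l : Fin m =>
    ∫ x in (0 : ℝ)..1, (x - 1 / t) ^ (a + (i : ℕ)) * x ^ ((l : ℕ) + b))
      ((-1) ^ a * t ^ (a + b + 1))
  simp only [Matrix.of_apply, Matrix.smul_of, Pi.smul_def, smul_eq_mul, Fintype.card_fin]
    at h1 h2 h3
  rw [h1, h2, h3, ← prod_pow_mul_prod_pow_mul, mul_pow]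
  ring

theorem det_poch_mul_jacobiP (m a b : ℕ) (t : ℝ) :
    (Matrix.of fun i j : Fin a =>
      poch ((m + ((i : ℕ) + 1) + b : ℕ) : ℝ) (j : ℕ) *
        jacobiP ((m : ℤ) + (i : ℕ) - (j : ℕ)) (j : ℕ) (b + (j : ℕ)) (2 / t - 1)).det =
      (∏ j ∈ Finset.range a, (j.factorial : ℝ)) *
        (Matrix.of fun i j : Fin a =>
          (Polynomial.taylor (1 / t) (shiftedJacobi b (m + i))).coeff j).det := by
  rw [← Fin.prod_univ_eq_prod_range, ← Matrix.det_mul_row]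
  congr 1
  ext i j
  have h := poch_mul_jacobiP b (m + i) j (1 / t)
  rw [show m + (i : ℕ) + b + 1 = m + ((i : ℕ) + 1) + b by ring, Nat.cast_add m (i : ℕ),
    show 2 * (1 / t) - 1 = 2 / t - 1 by ring] at h
  exact h


/-- The c.d.f. at `t` of the largest eigenvalue of the undeformed Jacobi unitary ensemble. -/
theorem cdf_undeformed_JUE (m n p : ℕ) (hm : 1 ≤ m) (hmn : m ≤ n) (hmp : m ≤ p)
    (t : ℝ) (ht0 : 0 < t) (ht1 : t ≤ 1) :
    K1 m n p *
      (∫ x in orderedRegion m t,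
        vdm x ^ 2 * ∏ j, x j ^ (p - m) * (1 - x j) ^ (n - m))
    = Kc m p (n - m) * ((Nat.factorial (n + p - 1) : ℝ) / (Nat.factorial (m + p - 1) : ℝ)) *
        t ^ (m * ((n - m) + (p - m) + m)) *
        (Matrix.of fun i j : Fin (n - m) =>
          poch ((m + ((i : ℕ) + 1) + (p - m) : ℕ) : ℝ) (j : ℕ) *
            jacobiP ((m : ℤ) + (i : ℕ) - (j : ℕ)) (j : ℕ) ((p - m) + (j : ℕ))
              (2 / t - 1)).det := by

  generalize ha : n - m = a
  generalize hb : p - m = b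
  obtain rfl : n = m + a := by omega
  obtain rfl : p = m + b := by omega
  have hK := K1_mul_prod_eq hm a b
  have hD := det_moment_mul_prod_choose hm a b (1 / t)
  have hC : (∏ k ∈ Finset.range (m + a), ((2 * k + b).choose k : ℝ)) ≠ 0 :=
    Finset.prod_ne_zero_iff.2 fun k _ => Nat.cast_ne_zero.2 (Nat.choose_pos (by omega)).ne'
  rw [setIntegral_orderedRegion_eq_det ht0, det_poch_mul_jacobiP]
  refine mul_right_cancel₀ hC ?_
  linear_combination K1 m (m + a) (m + b) * t ^ (m * (a + b + m)) * hD +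
    t ^ (m * (a + b + m)) * (Matrix.of fun i j : Fin a =>
      (Polynomial.taylor (1 / t) (shiftedJacobi b (m + i))).coeff j).det * hK
end

section
/- For all integers m, p ≥ 1, every real γ ≥ 0 and every real t > 0, if P_F = 1 − (t/(1+t))^{mp} and P_D = 1 − (t/(1+t))^{mp} · (1 + γ/(1+t))^{−p}, then P_D = 1 − (1 − P_F) / (1 + γ − γ (1 − P_F)^{1/(mp)})^{p}. -/
/-- Closed functional relation between the detection probability `P_D` and the
false-alarm probability `P_F` of the largest-root test in the balanced case `m = n`. -/
theorem roc_relation_balanced (m p : ℕ) (hm : 1 ≤ m) (hp : 1 ≤ p)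
    (γ : ℝ) (hγ : 0 ≤ γ) (t : ℝ) (ht : 0 < t) (PF PD : ℝ)
    (hPF : PF = 1 - (t / (1 + t)) ^ (m * p))
    (hPD : PD = 1 - (t / (1 + t)) ^ (m * p) * ((1 + γ / (1 + t)) ^ p)⁻¹) :
    PD = 1 - (1 - PF) / (1 + γ - γ * (1 - PF) ^ (1 / (m * p : ℝ))) ^ p := by
  have hroot : (1 - PF) ^ (1 / (m * p : ℝ)) = t / (1 + t) := by
    rw [hPF, sub_sub_cancel, one_div, ← Nat.cast_mul]
    exact Real.pow_rpow_inv_natCast (by positivity) (Nat.mul_ne_zero (by lia) (by lia))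
  have hden : 1 + γ - γ * (t / (1 + t)) = 1 + γ / (1 + t) := by
    field_simp
    ring
  rw [hroot, hden, hPD, hPF, sub_sub_cancel, div_eq_mul_inv (_ ^ (m * p))]
end

section
/- For every fixed integer m ≥ 1, every real γ > 0 and every P_F ∈ (0,1), the function p ↦ 1 − (1 − P_F) / (1 + γ − γ (1 − P_F)^{1/(mp)})^{p}, regarded as a function of the real variable p ∈ (0,∞), is strictly increasing on (0,∞). -/
/-- Two applications of Bernoulli's inequality: `x ↦ 1 + γ - γ * x` interacts with fractional
powers by a strict inequality. -/
theorem one_add_sub_mul_rpow_lt {γ a t : ℝ} (hγ : 0 < γ) (ha0 : 0 < a) (ha1 : a < 1)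
    (ht0 : 0 < t) (ht1 : t < 1) :
    (1 + γ - γ * a) ^ t < 1 + γ - γ * a ^ t := by
  have hpos : 0 < γ * (1 - a) := mul_pos hγ (by linarith)
  have h1 : (1 + (a - 1)) ^ t < 1 + t * (a - 1) :=
    rpow_one_add_lt_one_add_mul_self (by linarith) (by linarith) ht0 ht1
  have h2 : (1 + γ * (1 - a)) ^ t < 1 + t * (γ * (1 - a)) :=
    rpow_one_add_lt_one_add_mul_self (by linarith) hpos.ne' ht0 ht1
  rw [add_sub_cancel] at h1
  rw [show 1 + γ - γ * a = 1 + γ * (1 - a) by ring]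
  nlinarith [mul_lt_mul_of_pos_left h1 hγ]

/-- The detection probability of the largest-root test in the balanced case `m = n`
is strictly increasing in the (continuous) number of signal-plus-noise samples `p`. -/
theorem detection_strictMono_in_samples (m : ℕ) (hm : 1 ≤ m) (γ : ℝ) (hγ : 0 < γ)
    (PF : ℝ) (hPF : PF ∈ Set.Ioo (0 : ℝ) 1) :
    StrictMonoOn
      (fun p : ℝ => 1 - (1 - PF) / (1 + γ - γ * (1 - PF) ^ (1 / ((m : ℝ) * p))) ^ p)
      (Set.Ioi 0) := by
  intro p hp r hr hpr
  obtain ⟨hPF0, hPF1⟩ := hPF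
  rw [Set.mem_Ioi] at hp hr
  have hm0 : (0 : ℝ) < m := by exact_mod_cast hm
  have hq0 : 0 < 1 - PF := by linarith
  have ha0 : 0 < (1 - PF) ^ (1 / ((m : ℝ) * p)) := Real.rpow_pos_of_pos hq0 _
  have ha1 : (1 - PF) ^ (1 / ((m : ℝ) * p)) < 1 :=
    Real.rpow_lt_one hq0.le (by linarith) (by positivity)
  have hb : (1 - PF) ^ (1 / ((m : ℝ) * r)) = ((1 - PF) ^ (1 / ((m : ℝ) * p))) ^ (p / r) := by
    rw [← Real.rpow_mul hq0.le]
    congr 1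
    field_simp
  simp only [hb]
  generalize (1 - PF) ^ (1 / ((m : ℝ) * p)) = a at ha0 ha1
  have hbase : 0 < 1 + γ - γ * a := by nlinarith
  have hlt : (1 + γ - γ * a) ^ p < (1 + γ - γ * a ^ (p / r)) ^ r := by
    calc (1 + γ - γ * a) ^ p = ((1 + γ - γ * a) ^ (p / r)) ^ r := by
          rw [← Real.rpow_mul hbase.le, div_mul_cancel₀ _ hr.ne']
      _ < (1 + γ - γ * a ^ (p / r)) ^ r :=
          Real.rpow_lt_rpow (Real.rpow_nonneg hbase.le _)
            (one_add_sub_mul_rpow_lt hγ ha0 ha1 (div_pos hp hr) ((div_lt_one hr).2 hpr)) hr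
  exact sub_lt_sub_left (div_lt_div_of_pos_left hq0 (Real.rpow_pos_of_pos hbase _) hlt) 1
end

section
/- For all reals ν > 0, γ > 0 and P_F ∈ (0,1), define g(p) = 1 − (1 − P_F) / (1 + γ − γ (1 − P_F)^{1/(ν p²)})^{p} for real p > 0. Then g is differentiable on (0,∞) and g′(p) < 0 for every p > √( (−ln(1 − P_F)) / (ν · ln((γ+4)/(γ+2))) ). -/
/-- The upper bound `log b ≤ sinh (log b)`, cleared of denominators. -/
theorem mul_log_le_half_sq_sub_one {b : ℝ} (hb : 1 ≤ b) : b * Real.log b ≤ (b ^ 2 - 1) / 2 := by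
  have hb0 : 0 < b := by linarith
  have h := Real.self_le_sinh_iff.2 (Real.log_nonneg hb)
  rw [Real.sinh_log hb0] at h
  calc b * Real.log b ≤ b * ((b - b⁻¹) / 2) := by gcongr
    _ = (b ^ 2 - 1) / 2 := by field_simp

theorem mul_log_lt_of_lt_one {γ u : ℝ} (hγ : 0 < γ) (hu : (γ + 2) / (γ + 4) < u) (hu1 : u < 1) :
    (1 + γ - γ * u) * Real.log (1 + γ - γ * u) < 2 * γ * u * (-Real.log u) := by
  have hu0 : 0 < u := lt_trans (by positivity) hu
  rw [div_lt_iff₀ (by linarith)] at hu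
  have hlog := Real.log_lt_sub_one_of_pos hu0 hu1.ne
  have hw : 0 < γ * (1 - u) := mul_pos hγ (by linarith)
  calc (1 + γ - γ * u) * Real.log (1 + γ - γ * u)
      ≤ ((1 + γ - γ * u) ^ 2 - 1) / 2 := mul_log_le_half_sq_sub_one (by linarith)
    _ ≤ 2 * γ * u * (1 - u) := by nlinarith
    _ < 2 * γ * u * (-Real.log u) := by
      gcongr
      linarith

theorem one_lt_one_add_sub_mul_rpow {ν γ q p : ℝ} (hν : 0 < ν) (hγ : 0 < γ) (hq0 : 0 < q)
    (hq1 : q < 1) (hp : 0 < p) : 1 < 1 + γ - γ * q ^ (1 / (ν * p ^ 2)) := by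
  have : q ^ (1 / (ν * p ^ 2)) < 1 := Real.rpow_lt_one hq0.le hq1 (by positivity)
  nlinarith

theorem hasDerivAt_detection {ν γ q p : ℝ} (hν : 0 < ν) (hγ : 0 < γ) (hq0 : 0 < q)
    (hq1 : q < 1) (hp : 0 < p) :
    HasDerivAt (fun p : ℝ => 1 - q / (1 + γ - γ * q ^ (1 / (ν * p ^ 2))) ^ p)
      (q / (1 + γ - γ * q ^ (1 / (ν * p ^ 2))) ^ p / (1 + γ - γ * q ^ (1 / (ν * p ^ 2))) *
        ((1 + γ - γ * q ^ (1 / (ν * p ^ 2))) * Real.log (1 + γ - γ * q ^ (1 / (ν * p ^ 2))) -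
          2 * γ * q ^ (1 / (ν * p ^ 2)) * (-Real.log (q ^ (1 / (ν * p ^ 2)))))) p := by
  have hb := one_lt_one_add_sub_mul_rpow hν hγ hq0 hq1 hp
  have hb0 : 0 < 1 + γ - γ * q ^ (1 / (ν * p ^ 2)) := by linarith
  have hx : HasDerivAt (fun p : ℝ => 1 / (ν * p ^ 2)) (-2 / (ν * p ^ 3)) p := by
    have h := (((hasDerivAt_pow 2 p).const_mul ν).inv (by positivity))
    simp only [one_div]
    refine h.congr_deriv ?_
    push_cast
    field_simp
  have hu := (hx.const_rpow hq0).const_mul γ |>.const_sub (1 + γ)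
  have hpow := hu.rpow (hasDerivAt_id p) hb0
  have hB : 0 < (1 + γ - γ * q ^ (1 / (ν * p ^ 2))) ^ p := Real.rpow_pos_of_pos hb0 p
  refine (((hasDerivAt_const p q).div hpow hB.ne').const_sub 1).congr_deriv ?_
  rw [Real.log_rpow hq0]
  simp only [id]
  rw [Real.rpow_sub_one hb0.ne']
  generalize q ^ (1 / (ν * p ^ 2)) = u at *
  generalize 1 + γ - γ * u = b at *
  field_simp
  ring

/-- When the dimension scales as `m = ν p`, the detection probability
`g(p) = 1 − (1 − P_F)/(1 + γ − γ(1 − P_F)^{1/(ν p²)})^p` is differentiable on `(0,∞)`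
and strictly decreasing beyond the threshold `√(−ln(1−P_F)/(ν ln((γ+4)/(γ+2))))`. -/
theorem detection_decreasing_above_threshold (ν γ PF : ℝ) (hν : 0 < ν) (hγ : 0 < γ)
    (hPF : PF ∈ Set.Ioo (0 : ℝ) 1) :
    (∀ p ∈ Set.Ioi (0 : ℝ), DifferentiableAt ℝ
      (fun p : ℝ => 1 - (1 - PF) / (1 + γ - γ * (1 - PF) ^ (1 / (ν * p ^ 2))) ^ p) p) ∧
    ∀ p : ℝ,
      Real.sqrt ((-Real.log (1 - PF)) / (ν * Real.log ((γ + 4) / (γ + 2)))) < p →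
      deriv (fun p : ℝ => 1 - (1 - PF) / (1 + γ - γ * (1 - PF) ^ (1 / (ν * p ^ 2))) ^ p) p
        < 0 := by
  have hq0 : 0 < 1 - PF := by linarith [hPF.2]
  have hq1 : 1 - PF < 1 := by linarith [hPF.1]
  refine ⟨fun p hp => (hasDerivAt_detection hν hγ hq0 hq1 hp).differentiableAt, fun p hlt => ?_⟩
  have hp : 0 < p := (Real.sqrt_nonneg _).trans_lt hlt
  rw [(hasDerivAt_detection hν hγ hq0 hq1 hp).deriv]
  have hb := one_lt_one_add_sub_mul_rpow hν hγ hq0 hq1 hp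
  have hb0 : 0 < 1 + γ - γ * (1 - PF) ^ (1 / (ν * p ^ 2)) := by linarith
  refine mul_neg_of_pos_of_neg (by positivity) (sub_neg.2 (mul_log_lt_of_lt_one hγ ?_
    (Real.rpow_lt_one hq0.le hq1 (by positivity))))
  have hlog : 0 < Real.log ((γ + 4) / (γ + 2)) :=
    Real.log_pos ((one_lt_div (by linarith)).2 (by linarith))
  rw [Real.sqrt_lt' hp, div_lt_iff₀ (by positivity)] at hlt
  rw [Real.lt_rpow_iff_log_lt (by positivity) hq0, ← inv_div, Real.log_inv, one_div_mul_eq_div,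
    lt_div_iff₀ (by positivity)]
  linarith
end

section
/- For every P_F ∈ (0,1), every c ∈ (0,1] and every real θ ≥ 0, lim_{m→∞} [ 1 − (1 − P_F) · (1 + θ m (1 − (1 − P_F)^{c/m²}))^{−m/c} ] = 1 − (1 − P_F)^{1 + θ}, where the limit is taken over natural numbers m → ∞. -/
/-- If `q > 0`, then `y * (1 - q ^ (c / y))` tends to `-(c * log q)` as `y → ∞`. -/
lemma tendsto_mul_one_sub_rpow_div {q : ℝ} (hq : 0 < q) (c : ℝ) :
    Filter.Tendsto (fun y : ℝ => y * (1 - q ^ (c / y))) Filter.atTop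
      (nhds (-(c * Real.log q))) := by
  have hderiv : HasDerivAt (fun s : ℝ => q ^ (c * s)) (c * Real.log q) 0 := by
    simpa [mul_comm] using ((hasDerivAt_id (0 : ℝ)).const_mul c).const_rpow hq
  have hslope := hderiv.tendsto_slope_zero_right.comp tendsto_inv_atTop_nhdsGT_zero
  refine hslope.neg.congr fun y => ?_
  simp only [Function.comp_apply, zero_add, mul_zero, Real.rpow_zero, inv_inv, smul_eq_mul,
    div_eq_mul_inv]
  ring

/-- When the SNR scales linearly with the dimension (`γ = θ m`, `p = m/c`, `m = n`),
the ROC of the largest-root test converges to the nontrivial limit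
`P_D = 1 − (1 − P_F)^{1+θ}`. -/
theorem roc_limit_scaled_snr (PF : ℝ) (hPF : PF ∈ Set.Ioo (0 : ℝ) 1)
    (c : ℝ) (hc : c ∈ Set.Ioc (0 : ℝ) 1) (θ : ℝ) (hθ : 0 ≤ θ) :
    Filter.Tendsto
      (fun m : ℕ =>
        1 - (1 - PF) *
          (1 + θ * (m : ℝ) * (1 - (1 - PF) ^ (c / (m : ℝ) ^ 2))) ^ (-(m : ℝ) / c))
      Filter.atTop (nhds (1 - (1 - PF) ^ (1 + θ))) := by
  obtain ⟨hP0, hP1⟩ := hPF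
  obtain ⟨hc0, -⟩ := hc
  have hq : 0 < 1 - PF := by linarith
  have hg : Filter.Tendsto
      (fun x : ℝ => x * (θ * x * (1 - (1 - PF) ^ (c / x ^ 2)))) Filter.atTop
      (nhds (θ * -(c * Real.log (1 - PF)))) := by
    refine (((tendsto_mul_one_sub_rpow_div hq c).comp
      (Filter.tendsto_pow_atTop two_ne_zero)).const_mul θ).congr fun x => ?_
    simp only [Function.comp_apply]
    ring
  have hpow := ((Real.tendsto_one_add_rpow_exp_of_tendsto hg).rpow_const
    (p := -1 / c) (Or.inl (Real.exp_ne_zero _))).comp tendsto_natCast_atTop_atTop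
  have hlim : Real.exp (θ * -(c * Real.log (1 - PF))) ^ (-1 / c) = (1 - PF) ^ θ := by
    rw [← Real.exp_mul, Real.rpow_def_of_pos hq]
    congr 1
    field_simp
  rw [Real.rpow_add hq, Real.rpow_one, ← hlim]
  refine ((hpow.const_mul (1 - PF)).const_sub 1).congr fun m => ?_
  have hle : (1 - PF) ^ (c / (m : ℝ) ^ 2) ≤ 1 :=
    Real.rpow_le_one hq.le (by linarith) (by positivity)
  have hbase : 0 ≤ 1 + θ * (m : ℝ) * (1 - (1 - PF) ^ (c / (m : ℝ) ^ 2)) :=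
    add_nonneg zero_le_one (mul_nonneg (by positivity) (sub_nonneg.2 hle))
  simp only [Function.comp_apply]
  rw [← Real.rpow_mul hbase]
  congr 3
  ring
end

section
/- Fix integers α ≥ 1, β ≥ 0 and j with 1 ≤ j ≤ α, and fix a real x > 0. Then lim_{m→∞} Σ_{k=0}^{m+α−j} [ (m+α−j)! / (m+α−j−k)! ] · [ (m+β+j−2+k)! / (m+β+j−2)! ] · x^{k} / ( k! · (k+j−1)! · m^{2k} · (1 − x/m²)^{k} ) = Σ_{k=0}^{∞} x^{k} / ( k! · (k+j−1)! ), where the limit is taken over natural numbers m → ∞ (with m large enough that m² > x). -/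
open Filter Topology
open scoped Nat

theorem tendsto_natCast_add_const_div_natCast (d : ℝ) :
    Tendsto (fun m : ℕ => ((m : ℝ) + d) / m) atTop (𝓝 1) := by
  have h : Tendsto (fun m : ℕ => 1 + d / (m : ℝ)) atTop (𝓝 (1 + 0)) :=
    tendsto_const_nhds.add (tendsto_const_div_atTop_nhds_zero_nat d)
  rw [add_zero] at h
  refine h.congr' ?_
  filter_upwards [eventually_ge_atTop 1] with m hm
  have : (m : ℝ) ≠ 0 := by positivity
  field_simp

theorem tendsto_ascFactorial_div_pow (c k : ℕ) :
    Tendsto (fun m : ℕ => ((m + c).ascFactorial k : ℝ) / (m : ℝ) ^ k) atTop (𝓝 1) := by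
  induction k with
  | zero => simp
  | succ k ih =>
    have h := (tendsto_natCast_add_const_div_natCast ((c : ℝ) + k)).mul ih
    rw [one_mul] at h
    refine h.congr fun m => ?_
    rw [Nat.ascFactorial_succ, pow_succ']
    push_cast
    rw [div_mul_div_comm, add_assoc]

theorem tendsto_descFactorial_div_pow (c k : ℕ) :
    Tendsto (fun m : ℕ => ((m + c).descFactorial k : ℝ) / (m : ℝ) ^ k) atTop (𝓝 1) := by
  induction k with
  | zero => simp
  | succ k ih =>
    have h := (tendsto_natCast_add_const_div_natCast ((c : ℝ) - k)).mul ih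
    rw [one_mul] at h
    refine h.congr' ?_
    filter_upwards [eventually_ge_atTop k] with m hm
    rw [Nat.descFactorial_succ, pow_succ', Nat.cast_mul, Nat.cast_sub (by lia)]
    push_cast
    rw [div_mul_div_comm, add_sub_assoc]

theorem tendsto_one_sub_div_sq (x : ℝ) :
    Tendsto (fun m : ℕ => 1 - x / (m : ℝ) ^ 2) atTop (𝓝 1) := by
  have h : Tendsto (fun m : ℕ => x / (m : ℝ) ^ 2) atTop (𝓝 0) :=
    tendsto_const_nhds.div_atTop
      ((tendsto_pow_atTop two_ne_zero).comp tendsto_natCast_atTop_atTop)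
  simpa using h.const_sub 1

theorem descFactorial_mul_ascFactorial_div_pow_le {m c b C : ℕ} (hm : 1 ≤ m)
    (hC : 2 * c + b + 2 ≤ C) (k : ℕ) :
    ((m + c).descFactorial k : ℝ) / (m : ℝ) ^ k * (((m + b).ascFactorial k : ℝ) / (m : ℝ) ^ k)
      ≤ ((C : ℝ) ^ 2) ^ k := by
  rcases lt_or_ge (m + c) k with hk | hk
  · rw [Nat.descFactorial_of_lt hk]
    simp only [Nat.cast_zero, zero_div, zero_mul]
    positivity
  have hCm : m + b + (m + c) ≤ C * m := by nlinarith
  have hdesc : (m + c).descFactorial k ≤ (C * m) ^ k :=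
    (Nat.descFactorial_le_pow _ _).trans (Nat.pow_le_pow_left (by lia) k)
  have hasc : (m + b).ascFactorial k ≤ (C * m) ^ k := by
    obtain ⟨n, hn⟩ : ∃ n, m + b = n + 1 := ⟨m + b - 1, by lia⟩
    rw [hn]
    exact (Nat.ascFactorial_le_pow_add _ _).trans (Nat.pow_le_pow_left (by lia) k)
  have hm0 : (0 : ℝ) < (m : ℝ) ^ k := by positivity
  rw [← pow_mul, mul_comm 2 k, pow_mul, sq]
  gcongr
  · rw [div_le_iff₀ hm0, ← mul_pow]
    exact_mod_cast hdesc
  · rw [div_le_iff₀ hm0, ← mul_pow]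
    exact_mod_cast hasc

/-- Dominated convergence for the terms of the sum, with the ratios of factorials written as
falling and rising factorials. -/
theorem tendsto_tsum_descFactorial_mul_ascFactorial (c b : ℕ) {x : ℝ} (hx : 0 < x) {w : ℕ → ℝ}
    (hw : ∀ k, 0 ≤ w k) (hw' : ∀ k, w k ≤ 1 / (k ! : ℝ)) :
    Tendsto
      (fun m : ℕ => ∑' k : ℕ,
        ((m + c).descFactorial k : ℝ) / (m : ℝ) ^ k * (((m + b).ascFactorial k : ℝ) / (m : ℝ) ^ k) *
          (x ^ k * w k) / (1 - x / (m : ℝ) ^ 2) ^ k)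
      atTop (𝓝 (∑' k : ℕ, x ^ k * w k)) := by
  let C : ℕ := 2 * c + b + 2
  refine tendsto_tsum_of_dominated_convergence
    (bound := fun k => ((C : ℝ) ^ 2 * x * 2) ^ k / (k ! : ℝ))
    (Real.summable_pow_div_factorial _) (fun k => ?_) ?_
  · have h := (((tendsto_descFactorial_div_pow c k).mul (tendsto_ascFactorial_div_pow b k)).mul_const
      (x ^ k * w k)).div ((tendsto_one_sub_div_sq x).pow k) (by simp)
    simpa [Pi.div_def] using h
  · filter_upwards [eventually_ge_atTop 1,
      (tendsto_one_sub_div_sq x).eventually_const_le (show (1 / 2 : ℝ) < 1 by norm_num)]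
      with m hm hhalf k
    have hpos : 0 < 1 - x / (m : ℝ) ^ 2 := by linarith
    have hwk := hw k
    rw [Real.norm_of_nonneg (by positivity)]
    calc _ ≤ ((C : ℝ) ^ 2) ^ k * (x ^ k * (1 / (k ! : ℝ))) / (1 / 2) ^ k := by
          gcongr
          · exact descFactorial_mul_ascFactorial_div_pow_le hm le_rfl k
          · exact hw' k
      _ = _ := by
          rw [mul_pow, mul_pow, one_div_pow]
          field_simp


/-- Key term-wise limit in the derivation of the hard-edge scaling limit of the largest
eigenvalue of the Jacobi unitary ensemble: the finite hypergeometric-type sum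
`S_{k_j}(1 − x/m²)` converges as `m → ∞` to `Σ_{k≥0} x^k/(k!(k+j−1)!)`. -/
theorem hypergeometric_sum_limit (α β j : ℕ) (hα : 1 ≤ α) (hj1 : 1 ≤ j) (hjα : j ≤ α)
    (x : ℝ) (hx : 0 < x) :
    Filter.Tendsto
      (fun m : ℕ =>
        ∑ k ∈ Finset.range (m + α - j + 1),
          ((Nat.factorial (m + α - j) : ℝ) / (Nat.factorial (m + α - j - k) : ℝ)) *
            ((Nat.factorial (m + β + j - 2 + k) : ℝ) / (Nat.factorial (m + β + j - 2) : ℝ)) *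
            x ^ k /
            ((Nat.factorial k : ℝ) * (Nat.factorial (k + j - 1) : ℝ) * (m : ℝ) ^ (2 * k) *
              (1 - x / (m : ℝ) ^ 2) ^ k))
      Filter.atTop
      (nhds (∑' k : ℕ, x ^ k / ((Nat.factorial k : ℝ) * (Nat.factorial (k + j - 1) : ℝ)))) := by
  have hw : ∀ k : ℕ, 1 / ((k ! : ℝ) * ((k + j - 1)! : ℝ)) ≤ 1 / (k ! : ℝ) := fun k => by
    have h : (1 : ℝ) ≤ ((k + j - 1)! : ℝ) := by exact_mod_cast Nat.factorial_pos _
    gcongr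
    exact le_mul_of_one_le_right (by positivity) h
  have h := tendsto_tsum_descFactorial_mul_ascFactorial (α - j) (β + j - 1) hx
    (fun k => by positivity) hw
  simp only [mul_one_div] at h
  refine h.congr' ?_
  filter_upwards [eventually_ge_atTop 1] with m hm
  rw [tsum_eq_sum (s := Finset.range (m + α - j + 1)) fun k hk => ?_]
  · refine Finset.sum_congr rfl fun k hk => ?_
    have hk : k ≤ m + α - j := by simpa [Nat.lt_succ_iff] using hk
    have hdesc : ((m + α - j)! : ℝ) / ((m + α - j - k)! : ℝ) = ((m + α - j).descFactorial k : ℝ) := by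
      rw [← Nat.factorial_mul_descFactorial hk, Nat.cast_mul,
        mul_div_cancel_left₀ _ (by positivity)]
    have hasc : ((m + β + j - 2 + k)! : ℝ) / ((m + β + j - 2)! : ℝ) =
        ((m + β + j - 2 + 1).ascFactorial k : ℝ) := by
      rw [← Nat.factorial_mul_ascFactorial, Nat.cast_mul, mul_div_cancel_left₀ _ (by positivity)]
    rw [hdesc, hasc, show m + α - j = m + (α - j) by lia,
      show m + β + j - 2 + 1 = m + (β + j - 1) by lia]
    simp only [div_eq_mul_inv, mul_inv, two_mul, pow_add]
    ring
  · have hk : m + (α - j) < k := by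
      have : m + α - j + 1 ≤ k := by simpa using hk
      lia
    simp [Nat.descFactorial_of_lt hk]
end
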